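/- arXiv:1910.07343 — 2 statements merged into one kernel-verified Lean document; each statement's English description precedes it below -/
import Mathlib

section
/- Let X be a separable Banach space, F' a centred Gaussian random element of X. Then the norm ‖F'‖_X can be represented as a countable supremum sup_m |T_m(F')| over bounded linear functionals T_m ∈ X*, and the quantities E‖F'‖_X and τ² := sup_m E|T_m(F')|² are finite; moreover for every u > 0, P(‖F'‖_X ≥ E‖F'‖_X + u) ≤ exp(−u²/(2τ²)). -/
open MeasureTheory ProbabilityTheory

namespace GaussianConcentration

open Real Filter Topology

section Growth

variable {E F G : Type*} [NormedAddCommGroup E] [NormedAddCommGroup F] [NormedAddCommGroup G]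

/-- `f` grows at most exponentially in the norm of its argument. -/
def HasExpGrowth (f : E → F) : Prop :=
  ∃ a : ℝ, 0 ≤ a ∧ ∀ x, ‖f x‖ ≤ exp (a * (1 + ‖x‖))

lemma HasExpGrowth.mul {f g : E → ℝ} (hf : HasExpGrowth f) (hg : HasExpGrowth g) :
    HasExpGrowth fun x ↦ f x * g x := by
  obtain ⟨a, ha, hf⟩ := hf
  obtain ⟨b, hb, hg⟩ := hg
  refine ⟨a + b, by positivity, fun x ↦ ?_⟩
  rw [norm_mul, add_mul, exp_add]
  gcongr
  exacts [hf x, hg x]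

lemma HasExpGrowth.of_norm_le {f : E → F} {g : E → G} (hg : HasExpGrowth g)
    (h : ∀ x, ‖f x‖ ≤ ‖g x‖) : HasExpGrowth f := by
  obtain ⟨a, ha, hg⟩ := hg
  exact ⟨a, ha, fun x ↦ (h x).trans (hg x)⟩

lemma HasExpGrowth.of_norm_le_mul {f : E → F} {K : ℝ} (hK : 0 ≤ K)
    (h : ∀ x, ‖f x‖ ≤ K * (1 + ‖x‖)) : HasExpGrowth f := by
  refine ⟨K, hK, fun x ↦ (h x).trans ?_⟩
  linarith [add_one_le_exp (K * (1 + ‖x‖))]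

lemma HasExpGrowth.exp_mul {f : E → ℝ} {t : ℝ} (ht : 0 ≤ t) (h : ∀ x, |f x| ≤ 1 + ‖x‖) :
    HasExpGrowth fun x ↦ exp (t * f x) := by
  refine ⟨t, ht, fun x ↦ ?_⟩
  rw [Real.norm_eq_abs, abs_exp]
  gcongr
  exact (le_abs_self _).trans (h x)

lemma HasExpGrowth.comp {f : F → G} (hf : HasExpGrowth f) {g : E → F} {K : ℝ} (hK : 0 ≤ K)
    (hg : ∀ x, ‖g x‖ ≤ K * (1 + ‖x‖)) : HasExpGrowth fun x ↦ f (g x) := by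
  obtain ⟨a, ha, hf⟩ := hf
  refine ⟨a * (1 + K), by positivity, fun x ↦ (hf _).trans ?_⟩
  rw [exp_le_exp]
  nlinarith [mul_le_mul_of_nonneg_left (hg x) ha, mul_nonneg ha (norm_nonneg x)]

lemma HasExpGrowth.clm [NormedSpace ℝ E] [NormedSpace ℝ F] (L : E →L[ℝ] F) : HasExpGrowth L := by
  refine .of_norm_le_mul (norm_nonneg L) fun x ↦ (L.le_opNorm x).trans ?_
  gcongr
  linarith

end Growth

section Gaussian

variable {E : Type*} [NormedAddCommGroup E] [NormedSpace ℝ E] [CompleteSpace E]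
  [SecondCountableTopology E] [MeasurableSpace E] [BorelSpace E]

lemma integrable_exp_mul_one_add_norm (μ : Measure E) [IsGaussian μ] (a : ℝ) :
    Integrable (fun x ↦ exp (a * (1 + ‖x‖))) μ := by
  obtain ⟨C, hC, hint⟩ := IsGaussian.exists_integrable_exp_sq μ
  refine (hint.const_mul (exp (a + a ^ 2 / (4 * C)))).mono' (by fun_prop) (ae_of_all _ fun x ↦ ?_)
  rw [Real.norm_eq_abs, abs_exp, ← exp_add]
  gcongr
  have : a + a ^ 2 / (4 * C) + C * ‖x‖ ^ 2 - a * (1 + ‖x‖) = C * (‖x‖ - a / (2 * C)) ^ 2 := by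
    field_simp
    ring
  nlinarith [mul_nonneg hC.le (sq_nonneg (‖x‖ - a / (2 * C)))]

lemma HasExpGrowth.integrable {F : Type*} [NormedAddCommGroup F] {μ : Measure E} [IsGaussian μ]
    {f : E → F} (hf : HasExpGrowth f) (hm : AEStronglyMeasurable f μ) : Integrable f μ := by
  obtain ⟨a, -, hf⟩ := hf
  exact (integrable_exp_mul_one_add_norm μ a).mono' hm (ae_of_all _ hf)

lemma norm_rotation_apply_le {E : Type*} [NormedAddCommGroup E] [NormedSpace ℝ E] (θ : ℝ)
    (z : E × E) : ‖ContinuousLinearMap.rotation θ z‖ ≤ 2 * ‖z‖ := by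
  have key (a b : ℝ) (ha : |a| ≤ 1) (hb : |b| ≤ 1) : ‖a • z.1 + b • z.2‖ ≤ 2 * ‖z‖ := by
    refine (norm_add_le _ _).trans ?_
    rw [norm_smul, norm_smul, Real.norm_eq_abs, Real.norm_eq_abs]
    nlinarith [norm_fst_le z, norm_snd_le z, norm_nonneg z.1, norm_nonneg z.2]
  rw [ContinuousLinearMap.rotation_apply]
  exact max_le (key _ _ (abs_cos_le_one θ) (abs_sin_le_one θ))
    (key _ _ (by rw [abs_neg]; exact abs_sin_le_one θ) (abs_cos_le_one θ))

lemma rotation_add_pi_div_two {E : Type*} [NormedAddCommGroup E] [NormedSpace ℝ E] (θ : ℝ)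
    (z : E × E) :
    ContinuousLinearMap.rotation (θ + π / 2) z =
      ((ContinuousLinearMap.rotation θ z).2, -(ContinuousLinearMap.rotation θ z).1) := by
  simp [ContinuousLinearMap.rotation_apply, cos_add_pi_div_two, sin_add_pi_div_two, add_comm]

lemma hasDerivAt_rotation {E : Type*} [NormedAddCommGroup E] [NormedSpace ℝ E] (θ : ℝ)
    (z : E × E) :
    HasDerivAt (fun θ ↦ ContinuousLinearMap.rotation θ z)
      (ContinuousLinearMap.rotation (θ + π / 2) z) θ := by
  simp only [ContinuousLinearMap.rotation_apply, cos_add_pi_div_two, sin_add_pi_div_two]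
  exact (((hasDerivAt_cos θ).smul_const z.1).add ((hasDerivAt_sin θ).smul_const z.2)).prodMk
    (((hasDerivAt_sin θ).neg.smul_const z.1).add ((hasDerivAt_cos θ).smul_const z.2))

/-- Differentiation under the integral along the rotations of `E × E`. -/
lemma hasDerivAt_integral_rotation (ν : Measure (E × E)) [IsGaussian ν] {U V : E × E → ℝ}
    {U' : E × E → (E × E →L[ℝ] ℝ)} (hU : ∀ z, HasFDerivAt U (U' z) z) (hU' : Continuous U')
    (hV : Continuous V) (hUg : HasExpGrowth U) (hUg' : HasExpGrowth U') (hVg : HasExpGrowth V)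
    (θ : ℝ) :
    HasDerivAt (fun θ ↦ ∫ z, U (ContinuousLinearMap.rotation θ z) * V z ∂ν)
      (∫ z, U' (ContinuousLinearMap.rotation θ z)
        (ContinuousLinearMap.rotation (θ + π / 2) z) * V z ∂ν) θ := by
  have hUc : Continuous U := continuous_iff_continuousAt.2 fun z ↦ (hU z).continuousAt
  have hmeas (θ : ℝ) :
      AEStronglyMeasurable (fun z ↦ U (ContinuousLinearMap.rotation θ z) * V z) ν := by
    fun_prop
  have hrot : ∀ z : E × E, ‖ContinuousLinearMap.rotation θ z‖ ≤ 2 * (1 + ‖z‖) := fun z ↦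
    (norm_rotation_apply_le θ z).trans (by linarith)
  obtain ⟨a, ha, hUa⟩ := hUg'
  obtain ⟨b, hb, hVb⟩ := id hVg
  refine (hasDerivAt_integral_of_dominated_loc_of_deriv_le (s := Set.univ)
    (F' := fun θ z ↦ U' (ContinuousLinearMap.rotation θ z)
      (ContinuousLinearMap.rotation (θ + π / 2) z) * V z)
    (bound := fun z ↦ exp ((2 * a + 2 + b) * (1 + ‖z‖))) univ_mem
    (Eventually.of_forall hmeas)
    (((hUg.comp (by norm_num) hrot).mul hVg).integrable (hmeas θ))
    (Continuous.aestronglyMeasurable ?_) (ae_of_all _ fun z φ _ ↦ ?_)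
    (integrable_exp_mul_one_add_norm ν _) (ae_of_all _ fun z φ _ ↦ ?_)).2
  · exact ((hU'.comp (ContinuousLinearMap.rotation θ).continuous).clm_apply
      (ContinuousLinearMap.rotation _).continuous).mul hV
  · rw [norm_mul]
    have h1 : ‖U' (ContinuousLinearMap.rotation φ z)‖ ≤ exp (2 * a * (1 + ‖z‖)) := by
      refine (hUa _).trans ?_
      rw [exp_le_exp]
      nlinarith [mul_le_mul_of_nonneg_left (norm_rotation_apply_le φ z) ha]
    have h2 : ‖ContinuousLinearMap.rotation (φ + π / 2) z‖ ≤ exp (2 * (1 + ‖z‖)) := by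
      have := norm_rotation_apply_le (φ + π / 2) z
      linarith [add_one_le_exp (2 * (1 + ‖z‖))]
    calc ‖U' (ContinuousLinearMap.rotation φ z) (ContinuousLinearMap.rotation (φ + π / 2) z)‖ *
          ‖V z‖
        ≤ (‖U' (ContinuousLinearMap.rotation φ z)‖ *
            ‖ContinuousLinearMap.rotation (φ + π / 2) z‖) * ‖V z‖ := by
          gcongr
          exact ContinuousLinearMap.le_opNorm _ _
      _ ≤ (exp (2 * a * (1 + ‖z‖)) * exp (2 * (1 + ‖z‖))) * exp (b * (1 + ‖z‖)) := by
          gcongr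
          exact hVb z
      _ = _ := by rw [← exp_add, ← exp_add]; ring_nf
  · exact ((hU (ContinuousLinearMap.rotation φ z)).comp_hasDerivAt φ
      (hasDerivAt_rotation φ z)).mul_const _

/-- Gaussian integration by parts. -/
lemma integral_dual_mul_eq_integral_fderiv {μ : Measure E} [IsGaussian μ]
    (hμ : ∀ L : StrongDual ℝ E, μ[L] = 0) (L : E →L[ℝ] ℝ) {H : E → ℝ} {H' : E → (E →L[ℝ] ℝ)}
    (hH : ∀ x, HasFDerivAt H (H' x) x) (hH' : Continuous H') (hg : HasExpGrowth H)
    (hg' : HasExpGrowth H') :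
    ∫ x, L x * H x ∂μ = ∫ x, ∫ y, L y * H' x y ∂μ ∂μ := by
  have hHc : Continuous H := continuous_iff_continuousAt.2 fun z ↦ (hH z).continuousAt
  have hfst : ∀ z : E × E, ‖z.1‖ ≤ 1 * (1 + ‖z‖) := fun z ↦ by linarith [norm_fst_le z]
  have hsnd : ∀ z : E × E, ‖z.2‖ ≤ 1 * (1 + ‖z‖) := fun z ↦ by linarith [norm_snd_le z]
  have hLg : HasExpGrowth fun z : E × E ↦ L z.2 := (HasExpGrowth.clm L).comp zero_le_one hsnd
  have hHg : HasExpGrowth fun z : E × E ↦ H z.1 := hg.comp zero_le_one hfst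
  have hHg' : HasExpGrowth fun z : E × E ↦ H' z.1 := hg'.comp zero_le_one hfst
  let U : E × E → ℝ := fun z ↦ L z.2 * H z.1
  let U' : E × E → (E × E →L[ℝ] ℝ) := fun z ↦
    L z.2 • (H' z.1).comp (.fst ℝ E E) + H z.1 • L.comp (.snd ℝ E E)
  have hU (z : E × E) : HasFDerivAt U (U' z) z :=
    (L.hasFDerivAt.comp z hasFDerivAt_snd).mul ((hH z.1).comp z hasFDerivAt_fst)
  have hU' : Continuous U' := by
    exact ((L.continuous.comp continuous_snd).smul
      ((hH'.comp continuous_fst).clm_comp continuous_const)).add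
      ((hHc.comp continuous_fst).smul continuous_const)
  have hUg' : HasExpGrowth U' := by
    obtain ⟨a, ha, h1⟩ := hLg.mul (f := fun z : E × E ↦ L z.2) (g := fun z ↦ ‖H' z.1‖)
      (hHg'.of_norm_le fun z ↦ (norm_norm _).le)
    obtain ⟨b, hb, h2⟩ := hHg.mul (g := fun _ ↦ ‖L‖)
      (HasExpGrowth.of_norm_le_mul (norm_nonneg L) fun z ↦ by
        rw [norm_norm]; nlinarith [norm_nonneg L, norm_nonneg z])
    refine ⟨a + b + 1, by positivity, fun z ↦ ?_⟩
    have hz := norm_nonneg z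
    calc ‖U' z‖ ≤ ‖L z.2 * ‖H' z.1‖‖ + ‖H z.1 * ‖L‖‖ := by
          refine (norm_add_le _ _).trans ?_
          rw [norm_smul, norm_smul, norm_mul, norm_mul, norm_norm, norm_norm]
          gcongr
          · refine (ContinuousLinearMap.opNorm_comp_le _ _).trans ?_
            exact mul_le_of_le_one_right (norm_nonneg _) (ContinuousLinearMap.norm_fst_le ..)
          · refine (ContinuousLinearMap.opNorm_comp_le _ _).trans ?_
            exact mul_le_of_le_one_right (norm_nonneg _) (ContinuousLinearMap.norm_snd_le ..)
      _ ≤ exp (a * (1 + ‖z‖)) + exp (b * (1 + ‖z‖)) := add_le_add (h1 z) (h2 z)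
      _ ≤ exp ((a + b) * (1 + ‖z‖)) + exp ((a + b) * (1 + ‖z‖)) := by
          gcongr <;> linarith
      _ = exp ((a + b) * (1 + ‖z‖)) * 2 := by ring
      _ ≤ exp ((a + b) * (1 + ‖z‖)) * exp (1 + ‖z‖) := by
          gcongr
          linarith [add_one_le_exp (1 + ‖z‖)]
      _ = exp ((a + b + 1) * (1 + ‖z‖)) := by rw [← exp_add]; ring_nf
  have hderiv := hasDerivAt_integral_rotation (μ.prod μ) hU hU' (V := fun _ ↦ 1)
    continuous_const (hLg.mul hHg) hUg'
    (HasExpGrowth.of_norm_le_mul zero_le_one fun z ↦ by simp) 0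
  have hconst (θ : ℝ) : ∫ z, U (ContinuousLinearMap.rotation θ z) * 1 ∂(μ.prod μ)
      = ∫ z, U z ∂(μ.prod μ) := by
    conv_rhs => rw [← IsGaussian.map_rotation_eq_self_of_forall_strongDual_eq_zero hμ θ]
    rw [integral_map (by fun_prop)
      (Continuous.aestronglyMeasurable (by fun_prop))]
    simp
  simp only [hconst] at hderiv
  have hzero := hderiv.unique (hasDerivAt_const _ _)
  have hrot0 (z : E × E) : ContinuousLinearMap.rotation 0 z = z := by
    simp [ContinuousLinearMap.rotation_apply]
  have hmain : ∫ z : E × E, (L z.2 * H' z.1 z.2 - H z.1 * L z.1) ∂(μ.prod μ) = 0 := by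
    rw [← hzero]
    refine integral_congr_ae (ae_of_all _ fun z ↦ ?_)
    simp only [rotation_add_pi_div_two, hrot0, U']
    simp [sub_eq_add_neg]
  have hint1 : Integrable (fun z : E × E ↦ L z.2 * H' z.1 z.2) (μ.prod μ) := by
    refine HasExpGrowth.integrable (hLg.mul (HasExpGrowth.of_norm_le
      (g := fun z : E × E ↦ ‖H' z.1‖ * ‖z.2‖) (.mul (hHg'.of_norm_le fun z ↦ (norm_norm _).le)
      (.of_norm_le_mul zero_le_one fun z ↦ by rw [norm_norm]; exact hsnd z)) fun z ↦ ?_))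
      (Continuous.aestronglyMeasurable ?_)
    · rw [norm_mul, norm_norm, norm_norm]
      exact ContinuousLinearMap.le_opNorm _ _
    · exact (L.continuous.comp continuous_snd).mul
        ((hH'.comp continuous_fst).clm_apply continuous_snd)
  have hint2 : Integrable (fun z : E × E ↦ H z.1 * L z.1) (μ.prod μ) :=
    HasExpGrowth.integrable (hHg.mul ((HasExpGrowth.clm L).comp zero_le_one hfst))
      (by fun_prop)
  rw [integral_sub hint1 hint2, integral_prod _ hint1, sub_eq_zero] at hmain
  rw [hmain, integral_fun_fst (μ := μ) (ν := μ) fun x ↦ H x * L x]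
  simp [mul_comm]

/-- If `F` has a gradient whose values have pairwise covariance at most `s`, then the covariance of
`F` and `exp (t * F)` is at most `t * s * 𝔼 exp (t * F)`. -/
lemma integral_mul_exp_le {μ : Measure E} [IsGaussian μ]
    (hμ : ∀ L : StrongDual ℝ E, μ[L] = 0) {F : E → ℝ} {F' : E → (E →L[ℝ] ℝ)}
    (hF : ∀ x, HasFDerivAt F (F' x) x) (hF' : Continuous F') (hFb : ∀ x, |F x| ≤ 1 + ‖x‖)
    (hFb' : ∀ x, ‖F' x‖ ≤ 1) {s : ℝ} (hs : ∀ x y, ∫ z, F' x z * F' y z ∂μ ≤ s) {t : ℝ}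
    (ht : 0 ≤ t) :
    ∫ x, F x * exp (t * F x) ∂μ ≤ (∫ x, F x ∂μ + t * s) * ∫ x, exp (t * F x) ∂μ := by
  have hFc : Continuous F := continuous_iff_continuousAt.2 fun z ↦ (hF z).continuousAt
  have hfst : ∀ z : E × E, ‖z.1‖ ≤ 1 * (1 + ‖z‖) := fun z ↦ by linarith [norm_fst_le z]
  have hsnd : ∀ z : E × E, ‖z.2‖ ≤ 1 * (1 + ‖z‖) := fun z ↦ by linarith [norm_snd_le z]
  have hGg : HasExpGrowth fun x ↦ exp (t * F x) := .exp_mul ht hFb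
  set G : E → ℝ := fun x ↦ exp (t * F x) with hG
  have hGc : Continuous G := by fun_prop
  let φ : ℝ → ℝ := fun θ ↦ ∫ z, F (ContinuousLinearMap.rotation θ z).1 * G z.1 ∂(μ.prod μ)
  have hFg : HasExpGrowth F :=
    .of_norm_le_mul zero_le_one fun x ↦ by rw [one_mul]; exact hFb x
  have hFg' : HasExpGrowth F' := .of_norm_le_mul zero_le_one fun x ↦ by
    linarith [hFb' x, norm_nonneg x]
  have hrotg (θ : ℝ) : ∀ z : E × E, ‖(ContinuousLinearMap.rotation θ z).1‖ ≤ 2 * (1 + ‖z‖) :=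
    fun z ↦ (norm_fst_le _).trans ((norm_rotation_apply_le θ z).trans (by linarith))
  have hmap (θ : ℝ) {f : E × E → ℝ} (hf : Continuous f) :
      ∫ z, f (ContinuousLinearMap.rotation θ z) ∂(μ.prod μ) = ∫ z, f z ∂(μ.prod μ) := by
    conv_rhs => rw [← IsGaussian.map_rotation_eq_self_of_forall_strongDual_eq_zero hμ θ]
    rw [integral_map (by fun_prop) hf.aestronglyMeasurable]
  have hrotrot (θ : ℝ) (z : E × E) :
      (ContinuousLinearMap.rotation (-θ) (ContinuousLinearMap.rotation θ z)).1 = z.1 := by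
    simp only [ContinuousLinearMap.rotation_apply, cos_neg, sin_neg, smul_add, smul_smul]
    have : z.1 = (cos θ * cos θ + sin θ * sin θ) • z.1 := by
      rw [← sq, ← sq, cos_sq_add_sin_sq, one_smul]
    conv_rhs => rw [this]
    module
  have hc (θ : ℝ) : Continuous fun z : E × E ↦
      F' z.1 z.2 * G (ContinuousLinearMap.rotation (-θ) z).1 :=
    ((hF'.comp continuous_fst).clm_apply continuous_snd).mul (by fun_prop)
  have hint (θ : ℝ) : Integrable (fun z : E × E ↦
      F' z.1 z.2 * G (ContinuousLinearMap.rotation (-θ) z).1) (μ.prod μ) := by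
    refine HasExpGrowth.integrable (.mul (.of_norm_le_mul zero_le_one fun z ↦ ?_)
      (hGg.comp zero_le_two (hrotg _))) (hc θ).aestronglyMeasurable
    have h1 := (F' z.1).le_of_opNorm_le (hFb' z.1) z.2
    linarith [hsnd z]
  have hderiv (θ : ℝ) : HasDerivAt φ (∫ x, ∫ y,
      F' x y * G (ContinuousLinearMap.rotation (-θ) (x, y)).1 ∂μ ∂μ) θ := by
    have h := hasDerivAt_integral_rotation (μ.prod μ) (U := fun z ↦ F z.1)
      (U' := fun z ↦ (F' z.1).comp (.fst ℝ E E)) (V := fun z ↦ G z.1)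
      (fun z ↦ (hF z.1).comp z hasFDerivAt_fst)
      ((hF'.comp continuous_fst).clm_comp continuous_const) (by fun_prop)
      (hFg.comp zero_le_one hfst) ((hFg'.comp zero_le_one hfst).of_norm_le fun z ↦
        (ContinuousLinearMap.opNorm_comp_le _ _).trans
          (mul_le_of_le_one_right (norm_nonneg _) (ContinuousLinearMap.norm_fst_le ..)))
      (hGg.comp zero_le_one hfst) θ
    convert h using 1
    rw [← integral_prod (μ := μ) (ν := μ)
      (fun z ↦ F' z.1 z.2 * G (ContinuousLinearMap.rotation (-θ) z).1) (hint θ), ← hmap θ (hc θ)]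
    refine integral_congr_ae (ae_of_all _ fun z ↦ ?_)
    simp [hrotrot, rotation_add_pi_div_two]
  have hbound (θ : ℝ) (hθ : 0 ≤ sin θ) :
      -(t * s * sin θ) * ∫ x, G x ∂μ
        ≤ ∫ x, ∫ y, F' x y * G (ContinuousLinearMap.rotation (-θ) (x, y)).1 ∂μ ∂μ := by
    have hGint : Integrable (fun z ↦ G (ContinuousLinearMap.rotation (-θ) z).1) (μ.prod μ) :=
      (hGg.comp zero_le_two (hrotg _)).integrable (by fun_prop)
    have hGsum : ∫ x, G x ∂μ
        = ∫ x, ∫ y, G (ContinuousLinearMap.rotation (-θ) (x, y)).1 ∂μ ∂μ := by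
      rw [← integral_prod (μ := μ) (ν := μ)
        (fun z ↦ G (ContinuousLinearMap.rotation (-θ) z).1) hGint,
        hmap (-θ) (f := fun z ↦ G z.1) (by fun_prop), integral_fun_fst]
      simp
    rw [hGsum, ← integral_const_mul]
    refine integral_mono (hGint.integral_prod_left.const_mul _) (hint θ).integral_prod_left
      fun x ↦ ?_
    let p : E → E := fun y ↦ (ContinuousLinearMap.rotation (-θ) (x, y)).1
    have hp (y : E) : HasFDerivAt p (-sin θ • ContinuousLinearMap.id ℝ E) y := by
      simp only [p, ContinuousLinearMap.rotation_apply, sin_neg]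
      exact ((hasFDerivAt_id y).const_smul _).const_add _
    have hpc : Continuous p := by fun_prop
    have hpg (y : E) : ‖p y‖ ≤ 2 * (1 + ‖x‖) * (1 + ‖y‖) := by
      have h1 : ‖(x, y)‖ ≤ ‖x‖ + ‖y‖ :=
        max_le_add_of_nonneg (norm_nonneg x) (norm_nonneg y)
      nlinarith [hrotg (-θ) (x, y), mul_nonneg (norm_nonneg x) (norm_nonneg y)]
    have hHg : HasExpGrowth fun y ↦ G (p y) := hGg.comp (by positivity) hpg
    have hH (y : E) : HasFDerivAt (fun y ↦ G (p y))
        ((-(t * sin θ) * G (p y)) • F' (p y)) y := by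
      convert! (((hF (p y)).comp y (hp y)).const_mul t).exp using 1
      ext w
      simp [hG]
      ring
    have hH' : Continuous fun y ↦ (-(t * sin θ) * G (p y)) • F' (p y) :=
      (continuous_const.mul (hGc.comp hpc)).smul (hF'.comp hpc)
    have hH'g : HasExpGrowth fun y ↦ (-(t * sin θ) * G (p y)) • F' (p y) := by
      refine (HasExpGrowth.mul (f := fun _ : E ↦ -(t * sin θ))
        (.of_norm_le_mul (norm_nonneg (-(t * sin θ))) fun y ↦ ?_) hHg).of_norm_le fun y ↦ ?_
      · exact le_mul_of_one_le_right (norm_nonneg _) (by linarith [norm_nonneg y])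
      · rw [norm_smul]
        exact mul_le_of_le_one_right (norm_nonneg _) (hFb' _)
    have hHint : Integrable (fun y ↦ G (p y)) μ := hHg.integrable (by fun_prop)
    have hcint : Integrable (fun w ↦ F' x w • w) μ := by
      refine HasExpGrowth.integrable ?_ (by fun_prop)
      refine ((HasExpGrowth.clm (F' x)).mul (g := fun w ↦ ‖w‖)
        (.of_norm_le_mul zero_le_one fun w ↦ ?_)).of_norm_le fun w ↦ ?_
      · rw [norm_norm]; linarith
      · rw [norm_smul, norm_mul, norm_norm]
    have hcov (M : E →L[ℝ] ℝ) : ∫ w, F' x w * M w ∂μ = M (∫ w, F' x w • w ∂μ) := by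
      rw [← M.integral_comp_comm hcint]
      simp
    simp only
    rw [integral_dual_mul_eq_integral_fderiv hμ (F' x) hH hH' hHg hH'g]
    simp only [FunLike.coe_smul, Pi.smul_apply, smul_eq_mul, mul_left_comm (F' x _) (_ * _),
      integral_const_mul]
    rw [← integral_const_mul]
    refine integral_mono (hHint.const_mul _) ?_ fun y ↦ ?_
    · simp only [hcov]
      refine Integrable.mul_bdd (c := ‖∫ w, F' x w • w ∂μ‖) (hHint.const_mul _)
        (Continuous.aestronglyMeasurable ((hF'.comp hpc).clm_apply continuous_const))
        (ae_of_all _ fun y ↦ ?_)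
      simpa using (F' (p y)).le_of_opNorm_le (hFb' _) _
    · simp only
      have h0 : 0 ≤ t * sin θ * G (p y) := by positivity
      nlinarith [mul_le_mul_of_nonneg_left (hs x (p y)) h0]
  have hmono : MonotoneOn (fun θ ↦ φ θ - t * s * (∫ x, G x ∂μ) * cos θ) (Set.Icc 0 (π / 2)) := by
    have hd (θ : ℝ) := (hderiv θ).sub ((hasDerivAt_cos θ).const_mul (t * s * ∫ x, G x ∂μ))
    refine monotoneOn_of_deriv_nonneg (convex_Icc _ _)
      (fun θ _ ↦ (hd θ).continuousAt.continuousWithinAt)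
      (fun θ _ ↦ (hd θ).differentiableAt.differentiableWithinAt) fun θ hθ ↦ ?_
    rw [interior_Icc] at hθ
    have hd' := (hd θ).deriv
    simp only [Pi.sub_def] at hd'
    rw [hd']
    linarith [hbound θ (sin_nonneg_of_nonneg_of_le_pi hθ.1.le (by linarith [hθ.2, pi_pos]))]
  have h01 := hmono (Set.left_mem_Icc.2 (by positivity)) (Set.right_mem_Icc.2 (by positivity))
    (by positivity : (0 : ℝ) ≤ π / 2)
  have hφ0 : φ 0 = ∫ x, F x * G x ∂μ := by
    simp only [φ, ContinuousLinearMap.rotation_apply, cos_zero, sin_zero, one_smul, zero_smul,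
      add_zero]
    rw [integral_fun_fst (μ := μ) (ν := μ) fun x ↦ F x * G x]
    simp
  have hφ1 : φ (π / 2) = (∫ x, F x ∂μ) * ∫ x, G x ∂μ := by
    simp only [φ, ContinuousLinearMap.rotation_apply, cos_pi_div_two, sin_pi_div_two, one_smul,
      zero_smul, zero_add]
    rw [← integral_prod_mul, ← integral_prod_swap]
    rfl
  simp only [hφ0, hφ1, cos_zero, cos_pi_div_two] at h01
  linarith

/-- If `F` has a gradient whose values have pairwise covariance at most `s`, then `F` is
sub-Gaussian with variance proxy `s`. -/
lemma mgf_le_of_covariance_le {μ : Measure E} [IsGaussian μ]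
    (hμ : ∀ L : StrongDual ℝ E, μ[L] = 0) {F : E → ℝ} {F' : E → (E →L[ℝ] ℝ)}
    (hF : ∀ x, HasFDerivAt F (F' x) x) (hF' : Continuous F') (hFb : ∀ x, |F x| ≤ 1 + ‖x‖)
    (hFb' : ∀ x, ‖F' x‖ ≤ 1) {s : ℝ} (hs : ∀ x y, ∫ z, F' x z * F' y z ∂μ ≤ s) {t : ℝ}
    (ht : 0 ≤ t) :
    mgf F μ t ≤ exp (t * ∫ x, F x ∂μ + t ^ 2 * s / 2) := by
  have hFc : Continuous F := continuous_iff_continuousAt.2 fun z ↦ (hF z).continuousAt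
  have hint (v : ℝ) : Integrable (fun x ↦ exp (v * F x)) μ := by
    refine HasExpGrowth.integrable ⟨|v|, abs_nonneg v, fun x ↦ ?_⟩ (by fun_prop)
    rw [Real.norm_eq_abs, abs_exp, exp_le_exp]
    refine (le_abs_self _).trans ?_
    rw [abs_mul]
    gcongr
    exact hFb x
  have hset (v : ℝ) : v ∈ interior (integrableExpSet F μ) := by
    rw [show integrableExpSet F μ = Set.univ from Set.eq_univ_of_forall hint]
    simp
  have hdiff : Differentiable ℝ (cgf F μ) := fun v ↦ (analyticAt_cgf (hset v)).differentiableAt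
  have hanti : AntitoneOn (fun v ↦ cgf F μ v - (v * ∫ x, F x ∂μ + v ^ 2 * s / 2)) (Set.Ici 0) := by
    have hd (v : ℝ) := (hdiff v).hasDerivAt.sub (((hasDerivAt_id v).mul_const (∫ x, F x ∂μ)).add
      ((((hasDerivAt_id v).pow 2).mul_const s).div_const 2))
    refine antitoneOn_of_deriv_nonpos (convex_Ici _)
      (fun v _ ↦ (hd v).continuousAt.continuousWithinAt)
      (fun v _ ↦ (hd v).differentiableAt.differentiableWithinAt) fun v hv ↦ ?_
    rw [interior_Ici] at hv
    have hd' := (hd v).deriv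
    simp only [Pi.sub_def, Pi.add_def, Pi.pow_apply, id_eq] at hd'
    rw [hd', deriv_cgf (hset v)]
    have h1 : μ[fun x ↦ F x * exp (v * F x)] / mgf F μ v ≤ ∫ x, F x ∂μ + v * s :=
      (div_le_iff₀ (mgf_pos (hint v))).2 (integral_mul_exp_le hμ hF hF' hFb hFb' hs hv.le)
    norm_num
    linarith
  have h0 := hanti Set.self_mem_Ici ht ht
  simp only [cgf_zero] at h0
  rw [← exp_cgf (hint t), exp_le_exp]
  linarith

end Gaussian

section Smoothing

variable {E : Type*} [NormedAddCommGroup E] [NormedSpace ℝ E]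

/-- A smooth approximation of `max |T i x|` over `i ≤ n`. -/
noncomputable def softSup (T : ℕ → E →L[ℝ] ℝ) (n : ℕ) (x : E) : ℝ :=
  log (∑ i ∈ Finset.range (n + 1), cosh ((n + 1) * T i x)) / (n + 1)

/-- The weight of `T i` in the derivative of `softSup T n` at `x`. -/
noncomputable def softSupWeight (T : ℕ → E →L[ℝ] ℝ) (n : ℕ) (x : E) (i : ℕ) : ℝ :=
  sinh ((n + 1) * T i x) / ∑ j ∈ Finset.range (n + 1), cosh ((n + 1) * T j x)

variable (T : ℕ → E →L[ℝ] ℝ) (n : ℕ)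

lemma sum_cosh_pos (x : E) : 0 < ∑ i ∈ Finset.range (n + 1), cosh ((n + 1) * T i x) :=
  Finset.sum_pos (fun _ _ ↦ cosh_pos _) (by simp)

lemma hasFDerivAt_softSup (x : E) :
    HasFDerivAt (softSup T n) (∑ i ∈ Finset.range (n + 1), softSupWeight T n x i • T i) x := by
  have h : HasFDerivAt (fun x ↦ ∑ i ∈ Finset.range (n + 1), cosh ((n + 1) * T i x))
      (∑ i ∈ Finset.range (n + 1), sinh ((n + 1) * T i x) • ((n + 1 : ℝ) • T i)) x :=
    HasFDerivAt.fun_sum fun i _ ↦ ((T i).hasFDerivAt.const_mul _).cosh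
  convert! (h.log (sum_cosh_pos T n x).ne').mul_const ((n : ℝ) + 1)⁻¹ using 1
  simp only [Finset.smul_sum, smul_smul, softSupWeight]
  refine Finset.sum_congr rfl fun i _ ↦ ?_
  congr 1
  have : (n : ℝ) + 1 ≠ 0 := by positivity
  field_simp

lemma sum_abs_softSupWeight_le (x : E) :
    ∑ i ∈ Finset.range (n + 1), |softSupWeight T n x i| ≤ 1 := by
  simp only [softSupWeight, abs_div, ← Finset.sum_div, abs_of_pos (sum_cosh_pos T n x)]
  rw [div_le_one (sum_cosh_pos T n x)]
  refine Finset.sum_le_sum fun i _ ↦ ?_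
  rw [abs_le]
  have h := cosh_sq_sub_sinh_sq ((n + 1) * T i x)
  have := cosh_pos ((n + 1) * T i x)
  constructor <;> nlinarith

lemma continuous_fderiv_softSup :
    Continuous fun x ↦ ∑ i ∈ Finset.range (n + 1), softSupWeight T n x i • T i := by
  refine continuous_finsetSum _ fun i _ ↦ ?_
  have h : Continuous fun x ↦ softSupWeight T n x i :=
    Continuous.div (by fun_prop) (by fun_prop) fun x ↦ (sum_cosh_pos T n x).ne'
  exact h.smul continuous_const

variable {T}

lemma norm_sum_smul_le_one (hT : ∀ i, ‖T i‖ ≤ 1) {s : Finset ℕ} {a : ℕ → ℝ}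
    (ha : ∑ i ∈ s, |a i| ≤ 1) : ‖∑ i ∈ s, a i • T i‖ ≤ 1 := by
  refine (norm_sum_le_of_le _ fun i _ ↦ ?_).trans ha
  rw [norm_smul, Real.norm_eq_abs]
  exact mul_le_of_le_one_right (abs_nonneg _) (hT i)

lemma softSup_nonneg (x : E) : 0 ≤ softSup T n x := by
  refine div_nonneg (log_nonneg ?_) (by positivity)
  exact (one_le_cosh _).trans
    (Finset.single_le_sum (f := fun i ↦ cosh ((n + 1) * T i x)) (fun _ _ ↦ (cosh_pos _).le)
      (Finset.mem_range.2 n.succ_pos))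

lemma softSup_le (hT : ∀ i, ‖T i‖ ≤ 1) (x : E) :
    softSup T n x ≤ ‖x‖ + log (n + 1) / (n + 1) := by
  have hn : (0 : ℝ) < n + 1 := by positivity
  have h : ∑ i ∈ Finset.range (n + 1), cosh ((n + 1) * T i x)
      ≤ (n + 1) * exp ((n + 1) * ‖x‖) := by
    calc _ ≤ ∑ i ∈ Finset.range (n + 1), exp ((n + 1) * ‖x‖) := by
          refine Finset.sum_le_sum fun i _ ↦ ?_
          have hi : |T i x| ≤ ‖x‖ := by simpa using (T i).le_of_opNorm_le (hT i) x
          have hi' : |(n + 1) * T i x| ≤ (n + 1) * ‖x‖ := by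
            rw [abs_mul, abs_of_pos hn]
            gcongr
          rw [cosh_eq]
          linarith [exp_le_exp.2 ((le_abs_self _).trans hi'),
            exp_le_exp.2 ((neg_le_abs _).trans hi')]
      _ = _ := by simp
  rw [softSup, div_le_iff₀ hn, add_mul, div_mul_cancel₀ _ hn.ne']
  refine (log_le_log (sum_cosh_pos T n x) h).trans_eq ?_
  rw [log_mul hn.ne' (exp_pos _).ne', log_exp]
  ring

lemma abs_softSup_le (hT : ∀ i, ‖T i‖ ≤ 1) (x : E) : |softSup T n x| ≤ 1 + ‖x‖ := by
  have hn : (0 : ℝ) < n + 1 := by positivity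
  rw [abs_of_nonneg (softSup_nonneg n x)]
  have : log ((n : ℝ) + 1) / (n + 1) ≤ 1 :=
    (div_le_one hn).2 ((log_le_sub_one_of_pos hn).trans (by linarith))
  linarith [softSup_le n hT x]

lemma sub_le_softSup {m : ℕ} (hm : m ≤ n) (x : E) :
    |T m x| - log 2 / (n + 1) ≤ softSup T n x := by
  have hn : (0 : ℝ) < n + 1 := by positivity
  have h : exp ((n + 1) * |T m x|) / 2 ≤ ∑ i ∈ Finset.range (n + 1), cosh ((n + 1) * T i x) := by
    refine le_trans ?_ (Finset.single_le_sum (f := fun i ↦ cosh ((n + 1) * T i x))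
      (fun _ _ ↦ (cosh_pos _).le) (Finset.mem_range.2 (Nat.lt_succ_of_le hm)))
    rw [← cosh_abs, abs_mul, abs_of_pos hn, cosh_eq]
    linarith [exp_pos (-((n + 1) * |T m x|))]
  have h2 := log_le_log (by positivity) h
  rw [log_div (exp_pos _).ne' two_ne_zero, log_exp] at h2
  rw [softSup, le_div_iff₀ hn, sub_mul, div_mul_cancel₀ _ hn.ne']
  linarith

lemma tendsto_softSup (hT : ∀ i, ‖T i‖ ≤ 1) {x : E} (hx : ‖x‖ = ⨆ m, |T m x|) :
    Tendsto (fun n ↦ softSup T n x) atTop (𝓝 ‖x‖) := by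
  have hn : Tendsto (fun n : ℕ ↦ (n : ℝ) + 1) atTop atTop :=
    tendsto_atTop_add_const_right _ _ tendsto_natCast_atTop_atTop
  refine tendsto_order.2 ⟨fun a ha ↦ ?_, fun a ha ↦ ?_⟩
  · rw [hx] at ha
    obtain ⟨m, hm⟩ := exists_lt_of_lt_ciSup ha
    have hlim : Tendsto (fun n : ℕ ↦ |T m x| - log 2 / (n + 1)) atTop (𝓝 |T m x|) := by
      simpa using (hn.const_div_atTop (log 2)).const_sub |T m x|
    filter_upwards [hlim.eventually (lt_mem_nhds hm), eventually_ge_atTop m] with n h1 h2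
    exact h1.trans_le (sub_le_softSup n h2 x)
  · have hlim : Tendsto (fun n : ℕ ↦ ‖x‖ + log (n + 1) / (n + 1)) atTop (𝓝 ‖x‖) := by
      have := (isLittleO_log_id_atTop.tendsto_div_nhds_zero.comp hn).const_add ‖x‖
      simpa using this
    filter_upwards [hlim.eventually (gt_mem_nhds ha)] with n h1
    exact (softSup_le n hT x).trans_lt h1

end Smoothing

section Norm

variable {E : Type*} [NormedAddCommGroup E] [NormedSpace ℝ E]

/-- In a separable normed space, the norm is a supremum of countably many functionals in the dual
unit ball. -/
lemma exists_dual_seq_norm_eq_iSup [TopologicalSpace.SeparableSpace E] :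
    ∃ T : ℕ → (E →L[ℝ] ℝ), (∀ m, ‖T m‖ ≤ 1) ∧ ∀ x, ‖x‖ = ⨆ m, |T m x| := by
  choose T hT hTx using fun m ↦ exists_dual_vector'' ℝ (TopologicalSpace.denseSeq E m)
  have hle (m : ℕ) (x : E) : |T m x| ≤ ‖x‖ := by simpa using (T m).le_of_opNorm_le (hT m) x
  refine ⟨T, hT, fun x ↦ le_antisymm (le_of_forall_pos_le_add fun ε hε ↦ ?_) (ciSup_le (hle · x))⟩
  obtain ⟨m, hm⟩ := (TopologicalSpace.denseRange_denseSeq E).exists_dist_lt x (half_pos hε)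
  rw [dist_eq_norm] at hm
  set y := TopologicalSpace.denseSeq E m
  have hsup : |T m x| ≤ ⨆ m, |T m x| :=
    le_ciSup (f := fun m ↦ |T m x|) ⟨‖x‖, by rintro _ ⟨m, rfl⟩; exact hle m x⟩ m
  have h1 : ‖x‖ ≤ ‖x - y‖ + ‖y‖ := by simpa using norm_add_le (x - y) y
  have h2 : ‖y‖ = T m x - T m (x - y) := by
    rw [map_sub, hTx]
    simp [y]
  linarith [neg_abs_le (T m (x - y)), hle m (x - y), le_abs_self (T m x)]

variable [CompleteSpace E] [SecondCountableTopology E] [MeasurableSpace E] [BorelSpace E]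
  {μ : Measure E} [IsGaussian μ]

lemma integrable_dual_mul_dual (L M : E →L[ℝ] ℝ) : Integrable (fun x ↦ L x * M x) μ :=
  ((HasExpGrowth.clm L).mul (HasExpGrowth.clm M)).integrable (by fun_prop)

lemma integral_sum_smul_mul_sum_smul_le {T : ℕ → E →L[ℝ] ℝ} {v : ℝ}
    (hv : ∀ i, ∫ x, (T i x) ^ 2 ∂μ ≤ v) {s : Finset ℕ} {a b : ℕ → ℝ}
    (ha : ∑ i ∈ s, |a i| ≤ 1) (hb : ∑ i ∈ s, |b i| ≤ 1) :
    ∫ x, (∑ i ∈ s, a i • T i) x * (∑ i ∈ s, b i • T i) x ∂μ ≤ v := by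
  have hv0 : 0 ≤ v := (integral_nonneg fun x ↦ sq_nonneg (T 0 x)).trans (hv 0)
  have hcov (i j : ℕ) : |∫ x, T i x * T j x ∂μ| ≤ v := by
    have hi (i : ℕ) : Integrable (fun x ↦ (T i x) ^ 2) μ := by
      simpa only [sq] using integrable_dual_mul_dual (T i) (T i)
    calc |∫ x, T i x * T j x ∂μ| ≤ ∫ x, |T i x * T j x| ∂μ := abs_integral_le_integral_abs
      _ ≤ ∫ x, ((T i x) ^ 2 + (T j x) ^ 2) / 2 ∂μ := by
          refine integral_mono (integrable_dual_mul_dual _ _).abs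
            (((hi i).add (hi j)).div_const 2) fun x ↦ ?_
          simp only [abs_mul]
          nlinarith [sq_nonneg (|T i x| - |T j x|), sq_abs (T i x), sq_abs (T j x)]
      _ ≤ v := by
          rw [integral_div, integral_add (hi i) (hi j)]
          linarith [hv i, hv j]
  calc ∫ x, (∑ i ∈ s, a i • T i) x * (∑ i ∈ s, b i • T i) x ∂μ
      = ∫ x, ∑ i ∈ s, ∑ j ∈ s, a i * b j * (T i x * T j x) ∂μ := by
        refine integral_congr_ae (ae_of_all _ fun x ↦ ?_)
        simp only [FunLike.coe_sum, Finset.sum_apply, FunLike.coe_smul,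
          Pi.smul_apply, smul_eq_mul, Finset.sum_mul_sum]
        exact Finset.sum_congr rfl fun i _ ↦ Finset.sum_congr rfl fun j _ ↦ by ring
    _ = ∑ i ∈ s, ∑ j ∈ s, a i * b j * ∫ x, T i x * T j x ∂μ := by
        rw [integral_finsetSum _ fun i _ ↦ integrable_finsetSum _ fun j _ ↦
          (integrable_dual_mul_dual _ _).const_mul _]
        refine Finset.sum_congr rfl fun i _ ↦ ?_
        rw [integral_finsetSum _ fun j _ ↦ (integrable_dual_mul_dual _ _).const_mul _]
        simp only [integral_const_mul]
    _ ≤ ∑ i ∈ s, ∑ j ∈ s, |a i| * |b j| * v := by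
        refine Finset.sum_le_sum fun i _ ↦ Finset.sum_le_sum fun j _ ↦ (le_abs_self _).trans ?_
        rw [abs_mul, abs_mul]
        gcongr
        exact hcov i j
    _ = (∑ i ∈ s, |a i|) * (∑ i ∈ s, |b i|) * v := by
        simp only [← Finset.sum_mul, Finset.sum_mul_sum]
    _ ≤ v := mul_le_of_le_one_left hv0
        (mul_le_one₀ ha (Finset.sum_nonneg fun _ _ ↦ abs_nonneg _) hb)

lemma mgf_norm_le (hμ : ∀ L : StrongDual ℝ E, μ[L] = 0) {T : ℕ → E →L[ℝ] ℝ}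
    (hT : ∀ m, ‖T m‖ ≤ 1) (hTnorm : ∀ x, ‖x‖ = ⨆ m, |T m x|) {v : ℝ}
    (hv : ∀ i, ∫ x, (T i x) ^ 2 ∂μ ≤ v) {t : ℝ} (ht : 0 ≤ t) :
    mgf (fun x ↦ ‖x‖) μ t ≤ exp (t * ∫ x, ‖x‖ ∂μ + t ^ 2 * v / 2) := by
  have hcont (n : ℕ) : Continuous (softSup T n) :=
    continuous_iff_continuousAt.2 fun x ↦ (hasFDerivAt_softSup T n x).continuousAt
  have hmean : Tendsto (fun n ↦ ∫ x, softSup T n x ∂μ) atTop (𝓝 (∫ x, ‖x‖ ∂μ)) := by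
    refine tendsto_integral_of_dominated_convergence (fun x ↦ 1 + ‖x‖)
      (fun n ↦ (hcont n).aestronglyMeasurable) ?_ (fun n ↦ ae_of_all _ (abs_softSup_le n hT))
      (ae_of_all _ fun x ↦ tendsto_softSup hT (hTnorm x))
    exact (integrable_const _).add (IsGaussian.integrable_id (μ := μ)).norm
  have hmgf : Tendsto (fun n ↦ mgf (softSup T n) μ t) atTop (𝓝 (mgf (fun x ↦ ‖x‖) μ t)) := by
    refine tendsto_integral_of_dominated_convergence (fun x ↦ exp (t * (1 + ‖x‖)))
      (fun n ↦ Continuous.aestronglyMeasurable (by have := hcont n; fun_prop))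
      (integrable_exp_mul_one_add_norm μ t) (fun n ↦ ae_of_all _ fun x ↦ ?_)
      (ae_of_all _ fun x ↦ ((tendsto_softSup hT (hTnorm x)).const_mul t).rexp)
    rw [Real.norm_eq_abs, abs_exp]
    gcongr
    exact (le_abs_self _).trans (abs_softSup_le n hT x)
  exact le_of_tendsto_of_tendsto' hmgf ((hmean.const_mul t).add_const _).rexp fun n ↦
    mgf_le_of_covariance_le hμ (hasFDerivAt_softSup T n) (continuous_fderiv_softSup T n)
      (abs_softSup_le n hT) (fun x ↦ norm_sum_smul_le_one hT (sum_abs_softSupWeight_le T n x))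
      (fun x y ↦ integral_sum_smul_mul_sum_smul_le hv (sum_abs_softSupWeight_le T n x)
        (sum_abs_softSupWeight_le T n y)) ht

end Norm

end GaussianConcentration

/-- Gaussian concentration for the norm of a centred Gaussian random element of a
separable Banach space: the norm is a countable supremum of linear functionals,
it is integrable (Fernique), the weak variances are uniformly bounded, and the
Borell–Sudakov–Tsirelson inequality holds. -/
theorem gaussian_norm_concentration {X : Type*} [NormedAddCommGroup X]
    [NormedSpace ℝ X] [CompleteSpace X] [TopologicalSpace.SeparableSpace X]
    [MeasurableSpace X] [BorelSpace X]
    (μ : Measure X) [IsProbabilityMeasure μ]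
    (hGauss : ∀ L : X →L[ℝ] ℝ, ∃ v : NNReal,
      Measure.map L μ = gaussianReal 0 v) :
    ∃ T : ℕ → (X →L[ℝ] ℝ),
      (∀ x : X, ‖x‖ = ⨆ m : ℕ, |T m x|) ∧
      Integrable (fun x : X => ‖x‖) μ ∧
      BddAbove (Set.range fun m : ℕ => ∫ x, (T m x) ^ 2 ∂μ) ∧
      (∀ u : ℝ, 0 < u →
        (μ {x | (∫ y, ‖y‖ ∂μ) + u ≤ ‖x‖}).toReal
          ≤ Real.exp (-u ^ 2 / (2 * ⨆ m : ℕ, ∫ x, (T m x) ^ 2 ∂μ))) := by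
  have : SecondCountableTopology X := UniformSpace.secondCountable_of_separable X
  have hG : IsGaussian μ := isGaussian_of_map_eq_gaussianReal fun L ↦ ⟨0, hGauss L⟩
  have hμ (L : StrongDual ℝ X) : μ[L] = 0 := by
    obtain ⟨v, hv⟩ := hGauss L
    have h : ∫ x, x ∂(μ.map L) = ∫ x, L x ∂μ :=
      integral_map (by fun_prop) (by fun_prop)
    rw [← h, hv, integral_id_gaussianReal]
  obtain ⟨T, hT, hTnorm⟩ := GaussianConcentration.exists_dual_seq_norm_eq_iSup (E := X)
  have hbdd : BddAbove (Set.range fun m : ℕ => ∫ x, (T m x) ^ 2 ∂μ) := by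
    refine ⟨∫ x, ‖x‖ ^ 2 ∂μ, ?_⟩
    rintro _ ⟨m, rfl⟩
    refine integral_mono_of_nonneg (ae_of_all _ fun x ↦ sq_nonneg _)
      ((IsGaussian.memLp_two_id (μ := μ)).norm.integrable_sq) (ae_of_all _ fun x ↦ ?_)
    refine sq_le_sq' (abs_le.1 ?_).1 (abs_le.1 ?_).2 <;>
      simpa using (T m).le_of_opNorm_le (hT m) x
  refine ⟨T, hTnorm, (IsGaussian.integrable_id (μ := μ)).norm, hbdd, fun u hu ↦ ?_⟩
  set v := ⨆ m : ℕ, ∫ x, (T m x) ^ 2 ∂μ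
  have hv (m : ℕ) : ∫ x, (T m x) ^ 2 ∂μ ≤ v := le_ciSup hbdd m
  have hv0 : 0 ≤ v := (integral_nonneg fun x ↦ sq_nonneg (T 0 x)).trans (hv 0)
  rcases hv0.eq_or_lt with hv0 | hv0
  · rw [← hv0]
    exact (measureReal_le_one (μ := μ)).trans (by simp)
  have ht : 0 ≤ u / v := by positivity
  have hint : Integrable (fun x : X ↦ Real.exp (u / v * ‖x‖)) μ := by
    refine (GaussianConcentration.integrable_exp_mul_one_add_norm μ (u / v)).mono' (by fun_prop)
      (ae_of_all _ fun x ↦ ?_)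
    rw [Real.norm_eq_abs, Real.abs_exp]
    gcongr
    linarith
  refine (measure_ge_le_exp_mul_mgf _ ht hint).trans ?_
  refine (mul_le_mul_of_nonneg_left (GaussianConcentration.mgf_norm_le hμ hT hTnorm hv ht)
    (Real.exp_pos _).le).trans_eq ?_
  rw [← Real.exp_add]
  congr 1
  field_simp
  ring
end

section
/- Let Π' be a centred Gaussian measure on a separable Banach space X with RKHS H, and let B, Q, M > 0 be such that Π'(F : ‖F‖_X ≤ Q·ε) ≥ e^{−Bτ²} and M ≥ −2Φ_N^{−1}(e^{−Bτ²})/τ, where Φ_N is the standard normal CDF. Then Π'(F : F = F₁ + F₂ with ‖F₁‖_X ≤ Q·ε and ‖F₂‖_H ≤ M·τ) ≥ 1 − e^{−Bτ²}. -/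
open MeasureTheory ProbabilityTheory RealInnerProductSpace

/-- The standard normal cumulative distribution function. -/
noncomputable def normalCDF (t : ℝ) : ℝ := ((gaussianReal 0 1) (Set.Iic t)).toReal

namespace GaussianIsoperimetry

open Filter Topology

/-- The standard normal density. -/
noncomputable def normalPDF (x : ℝ) : ℝ := gaussianPDFReal 0 1 x

lemma normalPDF_eq (x : ℝ) :
    normalPDF x = (√(2 * Real.pi))⁻¹ * Real.exp (-x ^ 2 / 2) := by
  simp [normalPDF, gaussianPDFReal]

lemma normalPDF_pos (x : ℝ) : 0 < normalPDF x := gaussianPDFReal_pos 0 1 x one_ne_zero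

lemma normalPDF_neg (x : ℝ) : normalPDF (-x) = normalPDF x := by simp [normalPDF_eq]

lemma hasDerivAt_normalPDF (x : ℝ) : HasDerivAt normalPDF (-x * normalPDF x) x := by
  have h : HasDerivAt (fun x : ℝ => (√(2 * Real.pi))⁻¹ * Real.exp (-x ^ 2 / 2))
      ((√(2 * Real.pi))⁻¹ * (Real.exp (-x ^ 2 / 2) * (-(2 * x) / 2))) x := by
    have := ((((hasDerivAt_id x).pow 2).neg.div_const 2).exp.const_mul (√(2 * Real.pi))⁻¹)
    simpa using this
  have e : normalPDF = fun x : ℝ => (√(2 * Real.pi))⁻¹ * Real.exp (-x ^ 2 / 2) :=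
    funext normalPDF_eq
  rw [e]
  convert h using 1
  ring

lemma continuous_normalPDF : Continuous normalPDF :=
  continuous_iff_continuousAt.2 fun x => (hasDerivAt_normalPDF x).continuousAt

lemma normalPDF_le_one (x : ℝ) : normalPDF x ≤ 1 := by
  rw [normalPDF_eq]
  have h1 : 1 ≤ √(2 * Real.pi) := by
    rw [Real.one_le_sqrt]
    nlinarith [Real.pi_gt_three]
  have h2 : Real.exp (-x ^ 2 / 2) ≤ 1 := by
    rw [Real.exp_le_one_iff]
    nlinarith [sq_nonneg x]
  have h3 : (√(2 * Real.pi))⁻¹ ≤ 1 := inv_le_one_of_one_le₀ h1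
  exact mul_le_one₀ h3 (Real.exp_pos _).le h2

lemma abs_mul_normalPDF_le_one (x : ℝ) : |x| * normalPDF x ≤ 1 := by
  rw [normalPDF_eq]
  have h1 : 1 ≤ √(2 * Real.pi) := by
    rw [Real.one_le_sqrt]
    nlinarith [Real.pi_gt_three]
  have h3 : (√(2 * Real.pi))⁻¹ ≤ 1 := inv_le_one_of_one_le₀ h1
  have h2 : |x| * Real.exp (-x ^ 2 / 2) ≤ 1 := by
    have h4 : |x| ≤ Real.exp (x ^ 2 / 2) := by
      have := Real.add_one_le_exp (x ^ 2 / 2)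
      nlinarith [sq_nonneg (|x| - 1), sq_abs x]
    have h5 : Real.exp (x ^ 2 / 2) * Real.exp (-x ^ 2 / 2) = 1 := by
      rw [← Real.exp_add]
      ring_nf
      simp
    nlinarith [Real.exp_pos (-x ^ 2 / 2)]
  have h0 : 0 ≤ |x| * Real.exp (-x ^ 2 / 2) := by positivity
  calc |x| * ((√(2 * Real.pi))⁻¹ * Real.exp (-x ^ 2 / 2))
      = (√(2 * Real.pi))⁻¹ * (|x| * Real.exp (-x ^ 2 / 2)) := by ring
    _ ≤ 1 := mul_le_one₀ h3 h0 h2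

lemma normalPDF_le_of_abs_le {x y : ℝ} (h : |x| ≤ |y|) : normalPDF y ≤ normalPDF x := by
  rw [normalPDF_eq, normalPDF_eq]
  have := sq_le_sq.2 h
  gcongr

lemma normalCDF_eq_cdf : normalCDF = cdf (gaussianReal 0 1) := by
  ext x
  rw [cdf_eq_real]
  rfl

lemma normalCDF_eq_integral (x : ℝ) : normalCDF x = ∫ t in Set.Iic x, normalPDF t := by
  have h := gaussianReal_apply_eq_integral 0 one_ne_zero (Set.Iic x)
  rw [normalCDF, h, ENNReal.toReal_ofReal]
  · rfl
  · exact integral_nonneg fun t => (normalPDF_pos t).le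

lemma hasDerivAt_normalCDF (x : ℝ) : HasDerivAt normalCDF (normalPDF x) x := by
  have hi : Integrable normalPDF := integrable_gaussianPDFReal 0 1
  have e : normalCDF = fun y =>
      (∫ t in Set.Iic 0, normalPDF t) + ∫ t in (0 : ℝ)..y, normalPDF t := by
    ext y
    rw [normalCDF_eq_integral, ← intervalIntegral.integral_Iic_sub_Iic hi.integrableOn
      hi.integrableOn]
    ring
  rw [e]
  exact (intervalIntegral.integral_hasDerivAt_right hi.intervalIntegrable
    (continuous_normalPDF.stronglyMeasurableAtFilter _ _)
    continuous_normalPDF.continuousAt).const_add _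

lemma continuous_normalCDF : Continuous normalCDF :=
  continuous_iff_continuousAt.2 fun x => (hasDerivAt_normalCDF x).continuousAt

lemma strictMono_normalCDF : StrictMono normalCDF :=
  strictMono_of_hasDerivAt_pos hasDerivAt_normalCDF normalPDF_pos

lemma tendsto_normalCDF_atBot : Tendsto normalCDF atBot (𝓝 0) := by
  rw [normalCDF_eq_cdf]; exact tendsto_cdf_atBot _

lemma tendsto_normalCDF_atTop : Tendsto normalCDF atTop (𝓝 1) := by
  rw [normalCDF_eq_cdf]; exact tendsto_cdf_atTop _

lemma normalCDF_mem_Ioo (x : ℝ) : normalCDF x ∈ Set.Ioo (0 : ℝ) 1 := by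
  have h0 : 0 ≤ normalCDF (x - 1) := by rw [normalCDF_eq_cdf]; exact cdf_nonneg _ _
  have h1 : normalCDF (x + 1) ≤ 1 := by rw [normalCDF_eq_cdf]; exact cdf_le_one _ _
  exact ⟨h0.trans_lt (strictMono_normalCDF (by linarith)),
    (strictMono_normalCDF (by linarith)).trans_le h1⟩

lemma normalCDF_neg (x : ℝ) : normalCDF (-x) = 1 - normalCDF x := by
  have hd : ∀ y, HasDerivAt (fun y => normalCDF (-y) + normalCDF y) 0 y := by
    intro y
    have h := (hasDerivAt_normalCDF (-y)).comp y (hasDerivAt_neg y)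
    have := h.add (hasDerivAt_normalCDF y)
    refine this.congr_deriv ?_
    rw [normalPDF_neg]
    ring
  have hc : ∀ y z, (fun y => normalCDF (-y) + normalCDF y) y
      = (fun y => normalCDF (-y) + normalCDF y) z :=
    is_const_of_deriv_eq_zero (fun y => (hd y).differentiableAt) fun y => (hd y).deriv
  have ht : Tendsto (fun y => normalCDF (-y) + normalCDF y) atTop (𝓝 (0 + 1)) :=
    (tendsto_normalCDF_atBot.comp tendsto_neg_atTop_atBot).add tendsto_normalCDF_atTop
  have ht' : Tendsto (fun y => normalCDF (-y) + normalCDF y) atTop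
      (𝓝 (normalCDF (-x) + normalCDF x)) := by
    rw [show (fun y => normalCDF (-y) + normalCDF y)
      = fun _ => normalCDF (-x) + normalCDF x from funext fun y => hc y x]
    exact tendsto_const_nhds
  have := tendsto_nhds_unique ht ht'
  linarith

lemma exists_normalCDF_eq {p : ℝ} (hp : p ∈ Set.Ioo (0 : ℝ) 1) : ∃ x, normalCDF x = p := by
  obtain ⟨a, ha⟩ := (tendsto_normalCDF_atBot.eventually_lt_const hp.1).exists
  obtain ⟨b, hb⟩ := (tendsto_normalCDF_atTop.eventually_const_lt hp.2).exists
  exact mem_range_of_exists_le_of_exists_ge continuous_normalCDF ⟨a, ha.le⟩ ⟨b, hb.le⟩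

/-- The standard normal quantile function, the inverse of `normalCDF` on `(0, 1)`. -/
noncomputable def normalQuantile : ℝ → ℝ := Function.invFun normalCDF

lemma normalQuantile_normalCDF (x : ℝ) : normalQuantile (normalCDF x) = x :=
  Function.leftInverse_invFun strictMono_normalCDF.injective x

lemma normalCDF_normalQuantile {p : ℝ} (hp : p ∈ Set.Ioo (0 : ℝ) 1) :
    normalCDF (normalQuantile p) = p :=
  Function.invFun_eq (exists_normalCDF_eq hp)

lemma strictMonoOn_normalQuantile : StrictMonoOn normalQuantile (Set.Ioo 0 1) := by
  intro p hp r hr h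
  rw [← strictMono_normalCDF.lt_iff_lt, normalCDF_normalQuantile hp, normalCDF_normalQuantile hr]
  exact h

lemma continuousAt_normalQuantile {p : ℝ} (hp : p ∈ Set.Ioo (0 : ℝ) 1) :
    ContinuousAt normalQuantile p := by
  refine strictMonoOn_normalQuantile.continuousAt_of_image_mem_nhds
    (isOpen_Ioo.mem_nhds hp) ?_
  have : normalQuantile '' Set.Ioo 0 1 = Set.univ :=
    Set.eq_univ_of_forall fun x => ⟨normalCDF x, normalCDF_mem_Ioo x, normalQuantile_normalCDF x⟩
  rw [this]
  exact univ_mem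

lemma hasDerivAt_normalQuantile {p : ℝ} (hp : p ∈ Set.Ioo (0 : ℝ) 1) :
    HasDerivAt normalQuantile (normalPDF (normalQuantile p))⁻¹ p :=
  HasDerivAt.of_local_left_inverse (continuousAt_normalQuantile hp)
    (hasDerivAt_normalCDF _) (normalPDF_pos _).ne'
    (by filter_upwards [isOpen_Ioo.mem_nhds hp] with r hr using normalCDF_normalQuantile hr)

lemma one_sub_mem_Ioo {p : ℝ} (hp : p ∈ Set.Ioo (0 : ℝ) 1) : 1 - p ∈ Set.Ioo (0 : ℝ) 1 :=
  ⟨by linarith [hp.2], by linarith [hp.1]⟩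

lemma normalQuantile_one_sub {p : ℝ} (hp : p ∈ Set.Ioo (0 : ℝ) 1) :
    normalQuantile (1 - p) = -normalQuantile p := by
  rw [← normalQuantile_normalCDF (-normalQuantile p), normalCDF_neg, normalCDF_normalQuantile hp]

/-- The Gaussian isoperimetric profile `φ ∘ Φ⁻¹` on `(0, 1)`. -/
noncomputable def profile (p : ℝ) : ℝ := normalPDF (normalQuantile p)

lemma profile_pos (p : ℝ) : 0 < profile p := normalPDF_pos _

lemma profile_normalCDF (x : ℝ) : profile (normalCDF x) = normalPDF x := by
  rw [profile, normalQuantile_normalCDF]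

lemma profile_one_sub {p : ℝ} (hp : p ∈ Set.Ioo (0 : ℝ) 1) : profile (1 - p) = profile p := by
  rw [profile, normalQuantile_one_sub hp, normalPDF_neg, profile]

lemma hasDerivAt_profile {p : ℝ} (hp : p ∈ Set.Ioo (0 : ℝ) 1) :
    HasDerivAt profile (-normalQuantile p) p := by
  have h := (hasDerivAt_normalPDF (normalQuantile p)).comp p (hasDerivAt_normalQuantile hp)
  refine h.congr_deriv ?_
  have := (normalPDF_pos (normalQuantile p)).ne'
  field_simp

lemma hasDerivAt_profile_sq {p : ℝ} (hp : p ∈ Set.Ioo (0 : ℝ) 1) :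
    HasDerivAt (fun p => profile p ^ 2) (-2 * profile p * normalQuantile p) p := by
  refine ((hasDerivAt_profile hp).pow 2).congr_deriv ?_
  simp

lemma hasDerivAt_profile_mul_normalQuantile {p : ℝ} (hp : p ∈ Set.Ioo (0 : ℝ) 1) :
    HasDerivAt (fun p => -2 * profile p * normalQuantile p) (2 * normalQuantile p ^ 2 - 2) p := by
  refine (((hasDerivAt_profile hp).const_mul (-2)).mul
    (hasDerivAt_normalQuantile hp)).congr_deriv ?_
  have := (normalPDF_pos (normalQuantile p)).ne'
  simp only [profile]
  field_simp
  ring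

lemma hasDerivAt_normalQuantile_sq {p : ℝ} (hp : p ∈ Set.Ioo (0 : ℝ) 1) :
    HasDerivAt (fun p => normalQuantile p ^ 2) (2 * normalQuantile p * (profile p)⁻¹) p := by
  refine ((hasDerivAt_normalQuantile hp).pow 2).congr_deriv ?_
  simp [profile]

lemma hasDerivAt_normalQuantile_mul_inv_profile {p : ℝ} (hp : p ∈ Set.Ioo (0 : ℝ) 1) :
    HasDerivAt (fun p => 2 * normalQuantile p * (profile p)⁻¹)
      (2 * (1 + normalQuantile p ^ 2) * (profile p)⁻¹ ^ 2) p := by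
  refine (((hasDerivAt_normalQuantile hp).const_mul 2).mul
    ((hasDerivAt_profile hp).inv (profile_pos p).ne')).congr_deriv ?_
  have := (profile_pos p).ne'
  simp only [Pi.inv_apply, profile] at *
  field_simp

/-- A function with nonnegative second derivative lies above its tangent at `0`. -/
lemma tangent_le_of_second_deriv_nonneg {g g₁ g₂ : ℝ → ℝ} {x : ℝ} (hx : 0 ≤ x)
    (h₁ : ∀ t ∈ Set.Icc 0 x, HasDerivAt g (g₁ t) t)
    (h₂ : ∀ t ∈ Set.Icc 0 x, HasDerivAt g₁ (g₂ t) t)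
    (h : ∀ t ∈ Set.Icc 0 x, 0 ≤ g₂ t) : g 0 + g₁ 0 * x ≤ g x := by
  rcases hx.eq_or_lt with rfl | hx
  · simp
  obtain ⟨c, hc, hcs⟩ := exists_hasDerivAt_eq_slope g g₁ hx
    (fun t ht => (h₁ t ht).continuousAt.continuousWithinAt)
    (fun t ht => h₁ t ⟨ht.1.le, ht.2.le⟩)
  obtain ⟨d, hd, hds⟩ := exists_hasDerivAt_eq_slope g₁ g₂ hc.1
    (fun t ht => (h₂ t ⟨ht.1, ht.2.trans hc.2.le⟩).continuousAt.continuousWithinAt)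
    (fun t ht => h₂ t ⟨ht.1.le, ht.2.le.trans hc.2.le⟩)
  have hd0 := h d ⟨hd.1.le, hd.2.le.trans hc.2.le⟩
  rw [hds, sub_zero, div_nonneg_iff] at hd0
  rw [eq_div_iff (by linarith [hx])] at hcs
  rcases hd0 with ⟨h', -⟩ | ⟨-, h'⟩
  · nlinarith
  · linarith [hc.1]

section TwoPoint

variable {c x : ℝ}

lemma hasDerivAt_comp_const_add {f : ℝ → ℝ} {f' a t : ℝ} (h : HasDerivAt f f' (a + t)) :
    HasDerivAt (fun s => f (a + s)) f' t := by
  exact (h.comp t ((hasDerivAt_id t).const_add a)).congr_deriv (mul_one _)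

lemma hasDerivAt_comp_const_sub {f : ℝ → ℝ} {f' a t : ℝ} (h : HasDerivAt f f' (a - t)) :
    HasDerivAt (fun s => f (a - s)) (-f') t := by
  exact (h.comp t ((hasDerivAt_id t).const_sub a)).congr_deriv (by ring)

lemma two_mul_normalQuantile_sq_le (hx : 0 ≤ x) (h0 : 0 < c - x) (h1 : c + x < 1) :
    2 * normalQuantile c ^ 2 ≤ normalQuantile (c + x) ^ 2 + normalQuantile (c - x) ^ 2 := by
  have hp : ∀ t ∈ Set.Icc 0 x, c + t ∈ Set.Ioo (0 : ℝ) 1 := fun t ht =>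
    ⟨by linarith [ht.1], by linarith [ht.2]⟩
  have hm : ∀ t ∈ Set.Icc 0 x, c - t ∈ Set.Ioo (0 : ℝ) 1 := fun t ht =>
    ⟨by linarith [ht.2], by linarith [ht.1]⟩
  have := tangent_le_of_second_deriv_nonneg hx
    (fun t ht => (hasDerivAt_comp_const_add (hasDerivAt_normalQuantile_sq (hp t ht))).add
      (hasDerivAt_comp_const_sub (hasDerivAt_normalQuantile_sq (hm t ht))))
    (fun t ht => (hasDerivAt_comp_const_add
      (hasDerivAt_normalQuantile_mul_inv_profile (hp t ht))).add
      (hasDerivAt_comp_const_sub (hasDerivAt_normalQuantile_mul_inv_profile (hm t ht))).neg)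
    (fun t _ => by
      simp only [neg_neg]
      positivity)
  simp at this
  linarith

lemma profile_sq_add_lower (hx : 0 ≤ x) (h0 : 0 < c - x) (h1 : c + x < 1) :
    2 * profile c ^ 2 + 2 * (normalQuantile c ^ 2 - 1) * x ^ 2
      ≤ profile (c + x) ^ 2 + profile (c - x) ^ 2 := by
  have hp : ∀ t ∈ Set.Icc 0 x, c + t ∈ Set.Ioo (0 : ℝ) 1 := fun t ht =>
    ⟨by linarith [ht.1], by linarith [ht.2]⟩
  have hm : ∀ t ∈ Set.Icc 0 x, c - t ∈ Set.Ioo (0 : ℝ) 1 := fun t ht =>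
    ⟨by linarith [ht.2], by linarith [ht.1]⟩
  have hq (t : ℝ) : HasDerivAt (fun s => 2 * (normalQuantile c ^ 2 - 1) * s ^ 2)
      (4 * (normalQuantile c ^ 2 - 1) * t) t := by
    refine (((hasDerivAt_id t).pow 2).const_mul (2 * (normalQuantile c ^ 2 - 1))).congr_deriv ?_
    simp
    ring
  have hq' (t : ℝ) : HasDerivAt (fun s => 4 * (normalQuantile c ^ 2 - 1) * s)
      (4 * (normalQuantile c ^ 2 - 1)) t := by
    simpa using (hasDerivAt_id t).const_mul (4 * (normalQuantile c ^ 2 - 1))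
  have := tangent_le_of_second_deriv_nonneg hx
    (fun t ht => ((hasDerivAt_comp_const_add (hasDerivAt_profile_sq (hp t ht))).add
      (hasDerivAt_comp_const_sub (hasDerivAt_profile_sq (hm t ht)))).sub (hq t))
    (fun t ht => ((hasDerivAt_comp_const_add
      (hasDerivAt_profile_mul_normalQuantile (hp t ht))).add
      (hasDerivAt_comp_const_sub (hasDerivAt_profile_mul_normalQuantile (hm t ht))).neg).sub
        (hq' t))
    (fun t ht => by
      have := two_mul_normalQuantile_sq_le ht.1 (hm t ht).1 (hp t ht).2
      linarith)
  simp at this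
  linarith

lemma abs_normalQuantile_add_le (hx : 0 ≤ x) (h0 : 0 < c - x) (hc : c ≤ 1 / 2) :
    |normalQuantile (c + x)| ≤ |normalQuantile (c - x)| := by
  have hp : c + x ∈ Set.Ioo (0 : ℝ) 1 := ⟨by linarith, by linarith⟩
  have hm : c - x ∈ Set.Ioo (0 : ℝ) 1 := ⟨by linarith, by linarith⟩
  have e1 := strictMonoOn_normalQuantile.monotoneOn hm hp (by linarith)
  have e2 := strictMonoOn_normalQuantile.monotoneOn hp (one_sub_mem_Ioo hm) (by linarith)
  rw [normalQuantile_one_sub hm] at e2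
  rw [abs_of_nonpos (a := normalQuantile (c - x)) (by linarith), abs_le]
  constructor <;> linarith

lemma profile_sq_sub_sq_le (hx : 0 ≤ x) (h0 : 0 < c - x) (hc : c ≤ 1 / 2) :
    (profile (c + x) ^ 2 - profile (c - x) ^ 2) ^ 2
      ≤ 16 * profile c ^ 2 * normalQuantile c ^ 2 * x ^ 2 := by
  have hp : ∀ t ∈ Set.Icc 0 x, c + t ∈ Set.Ioo (0 : ℝ) 1 := fun t ht =>
    ⟨by linarith [ht.1], by linarith [ht.2]⟩
  have hm : ∀ t ∈ Set.Icc 0 x, c - t ∈ Set.Ioo (0 : ℝ) 1 := fun t ht =>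
    ⟨by linarith [ht.2], by linarith [ht.1]⟩
  have h := tangent_le_of_second_deriv_nonneg hx
    (fun t ht => (hasDerivAt_comp_const_sub (hasDerivAt_profile_sq (hm t ht))).sub
      (hasDerivAt_comp_const_add (hasDerivAt_profile_sq (hp t ht))))
    (fun t ht => (hasDerivAt_comp_const_sub
      (hasDerivAt_profile_mul_normalQuantile (hm t ht))).neg.sub
      (hasDerivAt_comp_const_add (hasDerivAt_profile_mul_normalQuantile (hp t ht))))
    (fun t ht => by
      have := sq_le_sq.2 (abs_normalQuantile_add_le ht.1 (hm t ht).1 hc)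
      linarith)
  simp at h
  have h2 : 0 ≤ profile (c + x) ^ 2 - profile (c - x) ^ 2 := by
    have := normalPDF_le_of_abs_le (abs_normalQuantile_add_le hx h0 hc)
    have h3 := profile_pos (c - x)
    simp only [profile] at *
    nlinarith
  have h3 : profile (c + x) ^ 2 - profile (c - x) ^ 2
      ≤ -(4 * profile c * normalQuantile c * x) := by linarith
  calc _ ≤ (-(4 * profile c * normalQuantile c * x)) ^ 2 := pow_le_pow_left₀ h2 h3 2
    _ = _ := by ring

lemma two_mul_le_sqrt_add_sqrt {A B K : ℝ} (hK : 0 ≤ K) (hA : 0 ≤ A) (hB : 0 ≤ B)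
    (h : (A - B) ^ 2 ≤ 8 * K ^ 2 * (A + B - 2 * K ^ 2)) : 2 * K ≤ √A + √B := by
  have h1 : 4 * K ^ 2 - (A + B) ≤ 2 * (√A * √B) := by
    rw [← Real.sqrt_mul hA]
    have : (4 * K ^ 2 - (A + B)) / 2 ≤ √(A * B) := by
      apply Real.le_sqrt_of_sq_le
      nlinarith
    linarith
  have := Real.sq_sqrt hA
  have := Real.sq_sqrt hB
  refine (sq_le_sq₀ (by positivity) (by positivity)).1 ?_
  nlinarith

lemma two_point_aux (hx : 0 ≤ x) (h0 : 0 < c - x) (hc : c ≤ 1 / 2) :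
    2 * profile c ≤ √(profile (c + x) ^ 2 + x ^ 2) + √(profile (c - x) ^ 2 + x ^ 2) := by
  apply two_mul_le_sqrt_add_sqrt (profile_pos c).le (by positivity) (by positivity)
  have h1 := profile_sq_add_lower hx h0 (by linarith)
  have h2 := profile_sq_sub_sq_le hx h0 hc
  have h3 := profile_pos c
  have h4 : 0 ≤ 8 * profile c ^ 2 := by positivity
  have := mul_le_mul_of_nonneg_left h1 h4
  nlinarith

/-- Bobkov's two-point inequality. -/
lemma two_point {a b : ℝ} (ha : a ∈ Set.Ioo (0 : ℝ) 1) (hb : b ∈ Set.Ioo (0 : ℝ) 1) :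
    2 * profile ((a + b) / 2)
      ≤ √(profile a ^ 2 + ((a - b) / 2) ^ 2) + √(profile b ^ 2 + ((a - b) / 2) ^ 2) := by
  wlog hab : b ≤ a generalizing a b
  · have := this hb ha (le_of_not_ge hab)
    rw [add_comm b a, show ((b - a) / 2) ^ 2 = ((a - b) / 2) ^ 2 by ring] at this
    linarith
  wlog hc : (a + b) / 2 ≤ 1 / 2 generalizing a b
  · have := this (one_sub_mem_Ioo hb) (one_sub_mem_Ioo ha) (by linarith) (by linarith)
    rw [profile_one_sub ha, profile_one_sub hb,
      show (1 - b + (1 - a)) / 2 = 1 - (a + b) / 2 by ring, profile_one_sub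
        ⟨by linarith [ha.1, hb.1], by linarith [ha.2, hb.2]⟩,
      show (1 - b - (1 - a)) / 2 = (a - b) / 2 by ring] at this
    linarith
  have := two_point_aux (c := (a + b) / 2) (x := (a - b) / 2) (by linarith)
    (by linarith [hb.1]) hc
  rwa [show (a + b) / 2 + (a - b) / 2 = a by ring,
    show (a + b) / 2 - (a - b) / 2 = b by ring] at this

end TwoPoint

lemma sqrt_sum_sq_add_sum_sq_le {ι : Type*} (s : Finset ι) (u v : ι → ℝ) :
    √((∑ i ∈ s, u i) ^ 2 + (∑ i ∈ s, v i) ^ 2) ≤ ∑ i ∈ s, √(u i ^ 2 + v i ^ 2) := by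
  have key (a b : ℝ) : √(a ^ 2 + b ^ 2) = ‖(⟨a, b⟩ : ℂ)‖ := by
    rw [Complex.norm_def, Complex.normSq_mk]
    ring_nf
  simp only [key]
  refine le_trans (le_of_eq ?_) (norm_sum_le s fun i => (⟨u i, v i⟩ : ℂ))
  congr 1
  apply Complex.ext <;> simp

lemma average_mem_Ioo {ι : Type*} [Fintype ι] {n : ℕ} (hn : Fintype.card ι = 2 ^ n)
    {f : ι → ℝ} (hf : ∀ i, f i ∈ Set.Ioo (0 : ℝ) 1) :
    (2 ^ n : ℝ)⁻¹ * ∑ i, f i ∈ Set.Ioo (0 : ℝ) 1 := by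
  have hne : (Finset.univ : Finset ι).Nonempty := by
    rw [← Finset.card_pos, Finset.card_univ, hn]
    positivity
  constructor
  · exact mul_pos (by positivity) (Finset.sum_pos (fun i _ => (hf i).1) hne)
  · rw [inv_mul_lt_iff₀ (by positivity), mul_one]
    calc ∑ i, f i < ∑ _i : ι, (1 : ℝ) := Finset.sum_lt_sum_of_nonempty hne fun i _ => (hf i).2
      _ = 2 ^ n := by simp [hn]

/-- Flip the coordinate `i` of a point of the discrete cube. -/
def flip {ι : Type*} [DecidableEq ι] (i : ι) (ω : ι → Bool) : ι → Bool :=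
  Function.update ω i (!ω i)

lemma sum_cube_succ {M : Type*} [AddCommMonoid M] {n : ℕ} (F : (Fin (n + 1) → Bool) → M) :
    ∑ ω, F ω =
      ∑ ω : Fin n → Bool, F (Fin.cons true ω) + ∑ ω : Fin n → Bool, F (Fin.cons false ω) := by
  rw [← (Fin.consEquiv fun _ => Bool).sum_comp, Fintype.sum_prod_type]
  simp [Fin.consEquiv]

lemma flip_cons_zero {n : ℕ} (b : Bool) (ω : Fin n → Bool) :
    flip 0 (Fin.cons b ω : Fin (n + 1) → Bool) = Fin.cons (!b) ω := by
  simp [flip]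

lemma flip_cons_succ {n : ℕ} (b : Bool) (ω : Fin n → Bool) (i : Fin n) :
    flip i.succ (Fin.cons b ω : Fin (n + 1) → Bool) = Fin.cons b (flip i ω) := by
  simp [flip, Fin.cons_update]

/-- Bobkov's functional inequality on the discrete cube indexed by `Fin n`. -/
lemma cube_inequality_fin {n : ℕ} (f : (Fin n → Bool) → ℝ) (hf : ∀ ω, f ω ∈ Set.Ioo (0 : ℝ) 1) :
    profile ((2 ^ n : ℝ)⁻¹ * ∑ ω, f ω) ≤ (2 ^ n : ℝ)⁻¹ *
      ∑ ω, √(profile (f ω) ^ 2 + ∑ i, ((f ω - f (flip i ω)) / 2) ^ 2) := by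
  induction n with
  | zero => simp [Real.sqrt_sq (profile_pos _).le]
  | succ n ih =>
    set K : ℝ := (2 ^ n : ℝ)⁻¹ with hK
    have hK0 : 0 < K := by positivity
    have hK' : (2 ^ (n + 1) : ℝ)⁻¹ = K / 2 := by rw [hK, pow_succ]; field_simp
    set g : Bool → (Fin n → Bool) → ℝ := fun b ω => f (Fin.cons b ω) with hg
    set u : Bool → (Fin n → Bool) → ℝ := fun b ω =>
      √(profile (g b ω) ^ 2 + ∑ i, ((g b ω - g b (flip i ω)) / 2) ^ 2) with hu
    set v : (Fin n → Bool) → ℝ := fun ω => (g true ω - g false ω) / 2 with hv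
    have hgm (b : Bool) : K * ∑ ω, g b ω ∈ Set.Ioo (0 : ℝ) 1 :=
      average_mem_Ioo (by simp) fun ω => hf _
    have hstep (b : Bool) : √(profile (K * ∑ ω, g b ω) ^ 2
        + ((K * ∑ ω, g true ω - K * ∑ ω, g false ω) / 2) ^ 2)
        ≤ K * ∑ ω, √(u b ω ^ 2 + v ω ^ 2) := by
      have h1 := ih (g b) fun ω => hf _
      have h2 : (K * ∑ ω, g true ω - K * ∑ ω, g false ω) / 2 = ∑ ω, K * v ω := by
        rw [← Finset.mul_sum, hv, ← Finset.sum_div, Finset.sum_sub_distrib]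
        ring
      calc _ ≤ √((∑ ω, K * u b ω) ^ 2 + (∑ ω, K * v ω) ^ 2) := by
            rw [h2]
            apply Real.sqrt_le_sqrt
            gcongr
            · exact (profile_pos _).le
            · rwa [← Finset.mul_sum]
        _ ≤ ∑ ω, √((K * u b ω) ^ 2 + (K * v ω) ^ 2) := sqrt_sum_sq_add_sum_sq_le _ _ _
        _ = K * ∑ ω, √(u b ω ^ 2 + v ω ^ 2) := by
            rw [Finset.mul_sum]
            refine Finset.sum_congr rfl fun ω _ => ?_
            rw [mul_pow, mul_pow, ← mul_add, Real.sqrt_mul (by positivity), Real.sqrt_sq hK0.le]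
    have hterm (b : Bool) (ω : Fin n → Bool) : √(u b ω ^ 2 + v ω ^ 2)
        = √(profile (f (Fin.cons b ω)) ^ 2
          + ∑ i, ((f (Fin.cons b ω) - f (flip i (Fin.cons b ω))) / 2) ^ 2) := by
      congr 1
      rw [hu]
      simp only
      rw [Real.sq_sqrt (by positivity), Fin.sum_univ_succ, flip_cons_zero]
      simp only [flip_cons_succ, hg, hv]
      cases b <;> simp <;> ring
    have h2 := two_point (hgm true) (hgm false)
    have ht := hstep true
    have hff := hstep false
    simp only [hterm] at ht hff
    rw [sum_cube_succ, sum_cube_succ, hK']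
    have e : K / 2 * (∑ ω, f (Fin.cons true ω) + ∑ ω, f (Fin.cons false ω))
        = (K * ∑ ω, g true ω + K * ∑ ω, g false ω) / 2 := by
      simp only [hg]
      ring
    rw [e]
    linarith

/-- Bobkov's functional inequality on the discrete cube. -/
lemma cube_inequality {ι : Type*} [Fintype ι] [DecidableEq ι] (f : (ι → Bool) → ℝ)
    (hf : ∀ ω, f ω ∈ Set.Ioo (0 : ℝ) 1) :
    profile ((2 ^ Fintype.card ι : ℝ)⁻¹ * ∑ ω, f ω) ≤ (2 ^ Fintype.card ι : ℝ)⁻¹ *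
      ∑ ω, √(profile (f ω) ^ 2 + ∑ i, ((f ω - f (flip i ω)) / 2) ^ 2) := by
  let e := Fintype.equivFin ι
  let E : (Fin (Fintype.card ι) → Bool) ≃ (ι → Bool) := e.symm.arrowCongr (Equiv.refl _)
  have hE (i : ι) (ω : Fin (Fintype.card ι) → Bool) : flip i (E ω) = E (flip (e i) ω) := by
    ext j
    simp [E, flip, Function.update_apply]
  have h := cube_inequality_fin (fun ω => f (E ω)) fun ω => hf _
  rw [← E.sum_comp, ← E.sum_comp]
  simp only [hE]
  convert h using 6 with ω
  rw [← e.sum_comp]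

section

/-- The sign `±1` encoded by a Boolean. -/
def sign (b : Bool) : ℝ := if b then 1 else -1

lemma sign_not (b : Bool) : sign (!b) = -sign b := by cases b <;> simp [sign]

lemma tendsto_cos_pow (a : ℝ) :
    Tendsto (fun N : ℕ => Complex.cos ((√(N : ℝ))⁻¹ * a : ℝ) ^ N) atTop
      (𝓝 (Complex.exp (-a ^ 2 / 2))) := by
  set P : Measure ℝ := (2 : ENNReal)⁻¹ • Measure.dirac 1 + (2 : ENNReal)⁻¹ • Measure.dirac (-1)
    with hP
  have : IsProbabilityMeasure P := ⟨by simp [hP, ENNReal.inv_two_add_inv_two]⟩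
  have hint {F : Type} [NormedAddCommGroup F] [NormedSpace ℝ F] [CompleteSpace F] (g : ℝ → F) :
      ∫ x, g x ∂P = (2 : ℝ)⁻¹ • g 1 + (2 : ℝ)⁻¹ • g (-1) := by
    rw [hP, integral_add_measure, integral_smul_measure, integral_smul_measure]
    · simp
    · exact (integrable_dirac (by simp)).smul_measure (by simp)
    · exact (integrable_dirac (by simp)).smul_measure (by simp)
  have h := tendsto_charFun_inv_sqrt_mul_pow (P := P) (X := id) aemeasurable_id
    (by rw [hint]; simp) (by
      simp only [Pi.pow_apply]
      rw [hint]; norm_num) a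
  refine h.congr fun N => ?_
  congr 1
  rw [Measure.map_id, charFun_apply_real, hint, Complex.cos]
  simp
  ring_nf

lemma sum_cube_prod {ι : Type*} [Fintype ι] [DecidableEq ι] (F : ι → Bool → ℂ) :
    ∑ ω : ι → Bool, ∏ i, F i (ω i) = ∏ i, (F i true + F i false) := by
  have := Finset.prod_univ_sum (fun _ : ι => (Finset.univ : Finset Bool)) F
  simp only [Fintype.piFinset_univ, Fintype.sum_bool] at this
  exact this.symm

variable {E : Type*} [NormedAddCommGroup E] [InnerProductSpace ℝ E]

/-- The normalised sum of `N` random signs in each direction of an orthonormal basis. -/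
noncomputable def walk {d : ℕ} (b : OrthonormalBasis (Fin d) ℝ E) (N : ℕ)
    (ω : Fin d × Fin N → Bool) : E :=
  (√(N : ℝ))⁻¹ • ∑ p, sign (ω p) • b p.1

lemma walk_flip {d : ℕ} (b : OrthonormalBasis (Fin d) ℝ E) (N : ℕ) (p : Fin d × Fin N)
    (ω : Fin d × Fin N → Bool) :
    walk b N (flip p ω) = walk b N ω + (-2 * sign (ω p) * (√(N : ℝ))⁻¹) • b p.1 := by
  have h : ∑ r, sign (flip p ω r) • b r.1
      = ∑ r, sign (ω r) • b r.1 + (-2 * sign (ω p)) • b p.1 := by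
    rw [← sub_eq_iff_eq_add', ← Finset.sum_sub_distrib, Finset.sum_eq_single p]
    · simp only [flip, Function.update_self, sign_not]
      module
    · intro r _ hr
      simp [flip, Function.update_of_ne hr]
    · simp
  rw [walk, h, smul_add, smul_smul, walk]
  congr 2
  ring

variable [MeasurableSpace E] [BorelSpace E]

/-- The law of `walk` under uniformly random signs. -/
noncomputable def walkLaw {d : ℕ} (b : OrthonormalBasis (Fin d) ℝ E) (N : ℕ) : Measure E :=
  ((2 : ENNReal) ^ Fintype.card (Fin d × Fin N))⁻¹ • ∑ ω, Measure.dirac (walk b N ω)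

instance {d : ℕ} (b : OrthonormalBasis (Fin d) ℝ E) (N : ℕ) :
    IsProbabilityMeasure (walkLaw b N) := ⟨by
  simp only [walkLaw, Measure.smul_apply, Measure.coe_finsetSum, Finset.sum_apply, measure_univ]
  simp [ENNReal.inv_mul_cancel]⟩

lemma integral_walkLaw {F : Type*} [NormedAddCommGroup F] [NormedSpace ℝ F] [CompleteSpace F]
    {d : ℕ} (b : OrthonormalBasis (Fin d) ℝ E) (N : ℕ) (g : E → F) :
    ∫ x, g x ∂walkLaw b N
      = ((2 : ℝ) ^ Fintype.card (Fin d × Fin N))⁻¹ • ∑ ω, g (walk b N ω) := by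
  rw [walkLaw, integral_smul_measure, integral_finsetSum_measure]
  · simp
  · exact fun ω _ => integrable_dirac (by simp)

lemma charFun_walkLaw {d : ℕ} (b : OrthonormalBasis (Fin d) ℝ E) (N : ℕ) (t : E) :
    charFun (walkLaw b N) t = ∏ j, Complex.cos ((√(N : ℝ))⁻¹ * ⟪b j, t⟫ : ℝ) ^ N := by
  rw [charFun_apply, integral_walkLaw]
  have h (ω : Fin d × Fin N → Bool) : Complex.exp (⟪walk b N ω, t⟫ * Complex.I)
      = ∏ p, Complex.exp (((√(N : ℝ))⁻¹ * (sign (ω p) * ⟪b p.1, t⟫) : ℝ) * Complex.I) := by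
    rw [← Complex.exp_sum, ← Finset.sum_mul, walk, inner_smul_left, sum_inner]
    simp [inner_smul_left, Finset.mul_sum]
  simp only [h]
  rw [sum_cube_prod fun (p : Fin d × Fin N) (c : Bool) =>
    Complex.exp (((√(N : ℝ))⁻¹ * (sign c * ⟪b p.1, t⟫) : ℝ) * Complex.I)]
  have h2 (p : Fin d × Fin N) :
      Complex.exp (((√(N : ℝ))⁻¹ * (sign true * ⟪b p.1, t⟫) : ℝ) * Complex.I)
        + Complex.exp (((√(N : ℝ))⁻¹ * (sign false * ⟪b p.1, t⟫) : ℝ) * Complex.I)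
      = 2 * Complex.cos ((√(N : ℝ))⁻¹ * ⟪b p.1, t⟫ : ℝ) := by
    rw [Complex.two_cos]
    simp [sign]
  simp only [h2]
  rw [Finset.prod_mul_distrib, Finset.prod_const, Finset.card_univ, Fintype.prod_prod_type]
  simp

lemma tendsto_integral_walkLaw [FiniteDimensional ℝ E] {d : ℕ}
    (b : OrthonormalBasis (Fin d) ℝ E) {g : E → ℝ} (hg : Continuous g) {C : ℝ}
    (hC : ∀ x, |g x| ≤ C) :
    Tendsto (fun N => ∫ x, g x ∂walkLaw b N) atTop (𝓝 (∫ x, g x ∂stdGaussian E)) := by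
  have h : Tendsto (β := ProbabilityMeasure E) (fun N => ⟨walkLaw b N, inferInstance⟩) atTop
      (𝓝 ⟨stdGaussian E, inferInstance⟩) := by
    refine ProbabilityMeasure.tendsto_iff_tendsto_charFun.2 fun t => ?_
    have e : charFun (stdGaussian E) t = ∏ j, Complex.exp (-(⟪b j, t⟫ : ℂ) ^ 2 / 2) := by
      rw [charFun_stdGaussian, ← Complex.exp_sum, ← Finset.sum_div, Finset.sum_neg_distrib]
      have := b.sum_sq_inner_right t
      congr 3
      rw [← Complex.ofReal_pow, ← this]
      simp
    change Tendsto (fun N => charFun (walkLaw b N) t) atTop (𝓝 (charFun (stdGaussian E) t))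
    rw [e]
    simp only [charFun_walkLaw]
    exact tendsto_finsetProd _ fun j _ => tendsto_cos_pow _
  exact (ProbabilityMeasure.tendsto_iff_forall_integral_tendsto.1 h)
    (BoundedContinuousFunction.ofNormedAddCommGroup g hg C hC)

end

section

lemma abs_normalPDF_sub_le (a c : ℝ) : |normalPDF c - normalPDF a| ≤ |c - a| := by
  have := Convex.norm_image_sub_le_of_norm_hasDerivWithin_le (f := normalPDF)
    (f' := fun x => -x * normalPDF x) (C := 1) (s := Set.univ) (x := a) (y := c)
    (fun x _ => (hasDerivAt_normalPDF x).hasDerivWithinAt)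
    (fun x _ => by
      rw [Real.norm_eq_abs, abs_mul, abs_neg, abs_of_pos (normalPDF_pos x)]
      exact abs_mul_normalPDF_le_one x) convex_univ trivial trivial
  simpa using this

lemma abs_normalCDF_sub_le (a c : ℝ) :
    |normalCDF c - normalCDF a| ≤ normalPDF a * |c - a| + |c - a| ^ 2 := by
  have key : ∃ z, |z - a| ≤ |c - a| ∧ normalCDF c - normalCDF a = normalPDF z * (c - a) := by
    rcases lt_trichotomy a c with h | rfl | h
    · obtain ⟨z, hz, e⟩ := exists_hasDerivAt_eq_slope normalCDF normalPDF h
        continuous_normalCDF.continuousOn fun t _ => hasDerivAt_normalCDF t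
      refine ⟨z, ?_, ?_⟩
      · rw [abs_of_pos (sub_pos.2 hz.1), abs_of_pos (sub_pos.2 h)]
        linarith [hz.2]
      · rw [e, div_mul_cancel₀ _ (sub_pos.2 h).ne']
    · exact ⟨a, le_rfl, by simp⟩
    · obtain ⟨z, hz, e⟩ := exists_hasDerivAt_eq_slope normalCDF normalPDF h
        continuous_normalCDF.continuousOn fun t _ => hasDerivAt_normalCDF t
      refine ⟨z, ?_, ?_⟩
      · rw [abs_of_neg (sub_neg.2 hz.2), abs_of_neg (sub_neg.2 h)]
        linarith [hz.1]
      · rw [e]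
        field_simp [(sub_pos.2 h).ne']
        ring
  obtain ⟨z, hz, e⟩ := key
  rw [e, abs_mul, abs_of_pos (normalPDF_pos z)]
  have h1 := (abs_le.1 (abs_normalPDF_sub_le a z)).2
  nlinarith [abs_nonneg (c - a)]

lemma integrable_normalCDF_comp {Ω : Type*} [MeasurableSpace Ω] (P : Measure Ω)
    [IsProbabilityMeasure P] {u : Ω → ℝ} (hu : Measurable u) :
    Integrable (fun ω => normalCDF (u ω)) P := by
  refine Integrable.of_bound (continuous_normalCDF.measurable.comp hu).aestronglyMeasurable 1 ?_
  filter_upwards with ω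
  have := normalCDF_mem_Ioo (u ω)
  rw [Real.norm_eq_abs, abs_of_pos this.1]
  exact this.2.le

lemma integral_normalCDF_comp_mem_Ioo {Ω : Type*} [MeasurableSpace Ω] (P : Measure Ω)
    [IsProbabilityMeasure P] {u : Ω → ℝ} (hu : Measurable u) :
    ∫ ω, normalCDF (u ω) ∂P ∈ Set.Ioo (0 : ℝ) 1 := by
  have hpos {w : Ω → ℝ} (hw : Measurable w) : 0 < ∫ ω, normalCDF (w ω) ∂P := by
    rw [integral_pos_iff_support_of_nonneg (fun ω => (normalCDF_mem_Ioo _).1.le)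
      (integrable_normalCDF_comp P hw)]
    have : Function.support (fun ω => normalCDF (w ω)) = Set.univ :=
      Set.eq_univ_of_forall fun ω => (normalCDF_mem_Ioo _).1.ne'
    simp [this]
  refine ⟨hpos hu, ?_⟩
  have h := hpos hu.neg
  simp only [Pi.neg_apply, normalCDF_neg] at h
  rw [integral_sub (integrable_const _) (integrable_normalCDF_comp P hu)] at h
  simp at h
  exact h

variable {E : Type*} [NormedAddCommGroup E] [InnerProductSpace ℝ E]

lemma sum_flip_sq_le {d : ℕ} (b : OrthonormalBasis (Fin d) ℝ E) {N : ℕ} (hN : 0 < N)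
    {u : E → ℝ} {G : E → E} {L C : ℝ} (hL : 0 ≤ L) (hC : 0 ≤ C) (hG : ∀ x, ‖G x‖ ≤ L)
    (hLip : ∀ x y, |u y - u x| ≤ L * ‖y - x‖)
    (hu : ∀ x y, |u y - u x - ⟪G x, y - x⟫| ≤ C * ‖y - x‖ ^ 2) (ω : Fin d × Fin N → Bool) :
    ∑ p, ((normalCDF (u (walk b N ω)) - normalCDF (u (walk b N (flip p ω)))) / 2) ^ 2
      ≤ normalPDF (u (walk b N ω)) ^ 2 * L ^ 2
        + d * (4 * (C + L ^ 2) * L + 4 * (C + L ^ 2) ^ 2) * (√(N : ℝ))⁻¹ := by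
  set x := walk b N ω
  set φ := normalPDF (u x)
  set K := C + L ^ 2 with hK
  set ρ := (√(N : ℝ))⁻¹ with hρ
  have hφ0 : 0 ≤ φ := (normalPDF_pos _).le
  have hφ1 : φ ≤ 1 := normalPDF_le_one _
  have hN' : (1 : ℝ) ≤ N := by exact_mod_cast hN
  have hρ0 : 0 < ρ := by positivity
  have hρ2 : N * ρ ^ 2 = 1 := by
    rw [hρ, inv_pow, Real.sq_sqrt (by positivity), mul_inv_cancel₀ (by positivity)]
  have hρ1 : ρ ≤ 1 := inv_le_one_of_one_le₀ (Real.one_le_sqrt.2 hN')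
  have hK0 : 0 ≤ K := by positivity
  have hterm (p : Fin d × Fin N) :
      ((normalCDF (u x) - normalCDF (u (walk b N (flip p ω)))) / 2) ^ 2
        ≤ φ ^ 2 * ⟪G x, b p.1⟫ ^ 2 * ρ ^ 2 + (4 * K * L + 4 * K ^ 2) * ρ * ρ ^ 2 := by
    rw [walk_flip]
    set s : ℝ := -2 * sign (ω p) * ρ with hs
    set y := x + s • b p.1 with hy
    have hsabs : |s| = 2 * ρ := by
      have : |sign (ω p)| = 1 := by cases ω p <;> simp [sign]
      rw [hs, abs_mul, abs_mul, this, abs_of_pos hρ0]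
      norm_num
    have hyx : y - x = s • b p.1 := by rw [hy]; abel
    have hnorm : ‖y - x‖ = 2 * ρ := by
      rw [hyx, norm_smul, Real.norm_eq_abs, hsabs, b.norm_eq_one, mul_one]
    have h1 := hu x y
    have h2 := hLip x y
    rw [hnorm] at h1 h2
    rw [hyx, inner_smul_right] at h1
    set g := ⟪G x, b p.1⟫ with hg
    have hgL : |g| ≤ L := by
      have := abs_real_inner_le_norm (G x) (b p.1)
      rw [b.norm_eq_one, mul_one] at this
      exact this.trans (hG x)
    have h3 : |u y - u x| ≤ 2 * ρ * |g| + C * (2 * ρ) ^ 2 := by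
      have := abs_add_le (u y - u x - s * g) (s * g)
      rw [sub_add_cancel, abs_mul s, hsabs] at this
      linarith
    have h4 := abs_normalCDF_sub_le (u x) (u y)
    have h5 : |normalCDF (u y) - normalCDF (u x)| / 2 ≤ φ * |g| * ρ + 2 * K * ρ ^ 2 := by
      have e1 : φ * |u y - u x| ≤ φ * (2 * ρ * |g|) + C * (2 * ρ) ^ 2 := by
        have := mul_le_mul_of_nonneg_left h3 hφ0
        have h6 : 0 ≤ C * (2 * ρ) ^ 2 := by positivity
        nlinarith
      have e2 : |u y - u x| ^ 2 ≤ (L * (2 * ρ)) ^ 2 := pow_le_pow_left₀ (abs_nonneg _) h2 2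
      rw [hK]
      nlinarith
    have h7 := pow_le_pow_left₀ (by positivity) h5 2
    have h8 : ((normalCDF (u x) - normalCDF (u y)) / 2) ^ 2
        = (|normalCDF (u y) - normalCDF (u x)| / 2) ^ 2 := by
      rw [div_pow, div_pow, sq_abs]
      ring
    rw [h8]
    refine h7.trans ?_
    have e3 : φ * |g| ≤ L := by nlinarith [abs_nonneg g]
    have e4 : φ * |g| * (4 * K * ρ ^ 3) ≤ L * (4 * K * ρ ^ 3) :=
      mul_le_mul_of_nonneg_right e3 (by positivity)
    have e5 : ρ * (4 * K ^ 2 * ρ ^ 3) ≤ 1 * (4 * K ^ 2 * ρ ^ 3) :=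
      mul_le_mul_of_nonneg_right hρ1 (by positivity)
    have e6 : (φ * |g| * ρ + 2 * K * ρ ^ 2) ^ 2
        = φ ^ 2 * |g| ^ 2 * ρ ^ 2 + φ * |g| * (4 * K * ρ ^ 3) + ρ * (4 * K ^ 2 * ρ ^ 3) := by ring
    rw [e6, sq_abs]
    nlinarith
  refine (Finset.sum_le_sum fun p _ => hterm p).trans ?_
  rw [Fintype.sum_prod_type]
  simp only [Finset.sum_const, Finset.card_univ, Fintype.card_fin, nsmul_eq_mul]
  have e7 (j : Fin d) : (N : ℝ) * (φ ^ 2 * ⟪G x, b j⟫ ^ 2 * ρ ^ 2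
      + (4 * K * L + 4 * K ^ 2) * ρ * ρ ^ 2)
      = φ ^ 2 * ⟪G x, b j⟫ ^ 2 + (4 * K * L + 4 * K ^ 2) * ρ := by
    linear_combination (φ ^ 2 * ⟪G x, b j⟫ ^ 2 + (4 * K * L + 4 * K ^ 2) * ρ) * hρ2
  simp only [e7, Finset.sum_add_distrib, ← Finset.mul_sum, b.sum_sq_inner_left]
  simp only [Finset.sum_const, Finset.card_univ, Fintype.card_fin, nsmul_eq_mul]
  have e8 : ‖G x‖ ^ 2 ≤ L ^ 2 := pow_le_pow_left₀ (norm_nonneg _) (hG x) 2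
  have := mul_le_mul_of_nonneg_left e8 (sq_nonneg φ)
  linarith

variable [MeasurableSpace E] [BorelSpace E]

lemma profile_integral_walkLaw_le {d : ℕ} (b : OrthonormalBasis (Fin d) ℝ E) {N : ℕ} (hN : 0 < N)
    {u : E → ℝ} {G : E → E} {L C : ℝ} (hL : 0 ≤ L) (hC : 0 ≤ C) (hG : ∀ x, ‖G x‖ ≤ L)
    (hLip : ∀ x y, |u y - u x| ≤ L * ‖y - x‖)
    (hu : ∀ x y, |u y - u x - ⟪G x, y - x⟫| ≤ C * ‖y - x‖ ^ 2) :
    profile (∫ x, normalCDF (u x) ∂walkLaw b N)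
      ≤ (1 + L) * ∫ x, normalPDF (u x) ∂walkLaw b N
        + √(d * (4 * (C + L ^ 2) * L + 4 * (C + L ^ 2) ^ 2) * (√(N : ℝ))⁻¹) := by
  set δ := d * (4 * (C + L ^ 2) * L + 4 * (C + L ^ 2) ^ 2) * (√(N : ℝ))⁻¹ with hδ
  have hδ0 : 0 ≤ δ := by positivity
  rw [integral_walkLaw, integral_walkLaw, smul_eq_mul, smul_eq_mul]
  refine (cube_inequality (fun ω => normalCDF (u (walk b N ω)))
    fun ω => normalCDF_mem_Ioo _).trans ?_
  have hterm (ω : Fin d × Fin N → Bool) :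
      √(profile (normalCDF (u (walk b N ω))) ^ 2 + ∑ p, ((normalCDF (u (walk b N ω))
        - normalCDF (u (walk b N (flip p ω)))) / 2) ^ 2)
      ≤ (1 + L) * normalPDF (u (walk b N ω)) + √δ := by
    have h := sum_flip_sq_le b hN hL hC hG hLip hu ω
    have h0 := normalPDF_pos (u (walk b N ω))
    rw [profile_normalCDF]
    apply Real.sqrt_le_iff.2 ⟨by positivity, ?_⟩
    have h1 := Real.sq_sqrt hδ0
    have h2 : 0 ≤ (1 + L) * normalPDF (u (walk b N ω)) * √δ := by positivity
    have h3 : 0 ≤ L * normalPDF (u (walk b N ω)) ^ 2 := by positivity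
    nlinarith
  calc _ ≤ ((2 : ℝ) ^ Fintype.card (Fin d × Fin N))⁻¹ *
        ∑ ω, ((1 + L) * normalPDF (u (walk b N ω)) + √δ) := by
        gcongr with ω
        exact hterm ω
    _ = _ := by
        rw [Finset.sum_add_distrib, ← Finset.mul_sum]
        simp
        field_simp

/-- The functional form of the Gaussian isoperimetric inequality for `Φ ∘ u`,
where `u` is Lipschitz with Lipschitz gradient. -/
lemma profile_integral_stdGaussian_le [FiniteDimensional ℝ E]
    {u : E → ℝ} {G : E → E} {L C : ℝ} (hL : 0 ≤ L) (hC : 0 ≤ C) (hG : ∀ x, ‖G x‖ ≤ L)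
    (hLip : ∀ x y, |u y - u x| ≤ L * ‖y - x‖)
    (hu : ∀ x y, |u y - u x - ⟪G x, y - x⟫| ≤ C * ‖y - x‖ ^ 2) :
    profile (∫ x, normalCDF (u x) ∂stdGaussian E)
      ≤ (1 + L) * ∫ x, normalPDF (u x) ∂stdGaussian E := by
  let b := stdOrthonormalBasis ℝ E
  have hcont : Continuous u := by
    refine (LipschitzWith.of_dist_le_mul (K := ⟨L, hL⟩) fun x y => ?_).continuous
    rw [Real.dist_eq, dist_eq_norm]
    exact hLip y x
  have h1 : Tendsto (fun N => ∫ x, normalCDF (u x) ∂walkLaw b N) atTop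
      (𝓝 (∫ x, normalCDF (u x) ∂stdGaussian E)) :=
    tendsto_integral_walkLaw b (continuous_normalCDF.comp hcont) (C := 1) fun x => by
      rw [abs_of_pos (normalCDF_mem_Ioo _).1]
      exact (normalCDF_mem_Ioo _).2.le
  have h2 : Tendsto (fun N => ∫ x, normalPDF (u x) ∂walkLaw b N) atTop
      (𝓝 (∫ x, normalPDF (u x) ∂stdGaussian E)) :=
    tendsto_integral_walkLaw b (continuous_normalPDF.comp hcont) (C := 1) fun x => by
      rw [abs_of_pos (normalPDF_pos _)]
      exact normalPDF_le_one _
  have h3 := (hasDerivAt_profile (integral_normalCDF_comp_mem_Ioo (stdGaussian E)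
    hcont.measurable)).continuousAt.tendsto.comp h1
  have h4 : Tendsto (fun N : ℕ => (√(N : ℝ))⁻¹) atTop (𝓝 0) :=
    tendsto_inv_atTop_zero.comp (Real.tendsto_sqrt_atTop.comp tendsto_natCast_atTop_atTop)
  have h5 := (h2.const_mul (1 + L)).add
    ((h4.const_mul (Module.finrank ℝ E * (4 * (C + L ^ 2) * L + 4 * (C + L ^ 2) ^ 2))).sqrt)
  rw [mul_zero, Real.sqrt_zero, add_zero] at h5
  refine le_of_tendsto_of_tendsto h3 h5 ?_
  filter_upwards [eventually_gt_atTop 0] with N hN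
  exact profile_integral_walkLaw_le b hN hL hC hG hLip hu

lemma hasDerivAt_integral_normalCDF_add {Ω : Type*} [MeasurableSpace Ω] (P : Measure Ω)
    [IsProbabilityMeasure P] {u : Ω → ℝ} (hu : Measurable u) (s : ℝ) :
    HasDerivAt (fun s => ∫ ω, normalCDF (u ω + s) ∂P) (∫ ω, normalPDF (u ω + s) ∂P) s := by
  refine (hasDerivAt_integral_of_dominated_loc_of_deriv_le (bound := fun _ => 1)
    (F' := fun s ω => normalPDF (u ω + s)) (s := Set.univ) univ_mem ?_
    (integrable_normalCDF_comp P (hu.add_const s)) ?_ ?_ (integrable_const _) ?_).2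
  · exact Eventually.of_forall fun s =>
      (integrable_normalCDF_comp P (hu.add_const s)).aestronglyMeasurable
  · exact (continuous_normalPDF.measurable.comp (hu.add_const s)).aestronglyMeasurable
  · filter_upwards with ω s _
    rw [Real.norm_eq_abs, abs_of_pos (normalPDF_pos _)]
    exact normalPDF_le_one _
  · filter_upwards with ω s _
    exact hasDerivAt_comp_const_add (hasDerivAt_normalCDF _)

/-- Integrated form of the functional isoperimetric inequality. -/
lemma normalQuantile_integral_add_le [FiniteDimensional ℝ E]
    {u : E → ℝ} {G : E → E} {L C : ℝ} (hL : 0 ≤ L) (hC : 0 ≤ C) (hG : ∀ x, ‖G x‖ ≤ L)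
    (hLip : ∀ x y, |u y - u x| ≤ L * ‖y - x‖)
    (hu : ∀ x y, |u y - u x - ⟪G x, y - x⟫| ≤ C * ‖y - x‖ ^ 2) {s t : ℝ} (hst : s ≤ t) :
    normalQuantile (∫ x, normalCDF (u x + s) ∂stdGaussian E) + (t - s) / (1 + L)
      ≤ normalQuantile (∫ x, normalCDF (u x + t) ∂stdGaussian E) := by
  have hcont : Continuous u := by
    refine (LipschitzWith.of_dist_le_mul (K := ⟨L, hL⟩) fun x y => ?_).continuous
    rw [Real.dist_eq, dist_eq_norm]
    exact hLip y x
  have hmem (r : ℝ) : ∫ x, normalCDF (u x + r) ∂stdGaussian E ∈ Set.Ioo (0 : ℝ) 1 :=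
    integral_normalCDF_comp_mem_Ioo _ (hcont.measurable.add_const r)
  have hd (r : ℝ) := (hasDerivAt_normalQuantile (hmem r)).comp r
    (hasDerivAt_integral_normalCDF_add (stdGaussian E) hcont.measurable r)
  have := mul_sub_le_image_sub_of_le_deriv (C := (1 + L)⁻¹)
    (fun r => (hd r).differentiableAt) (fun r => by
      rw [(hd r).deriv]
      have h := profile_integral_stdGaussian_le (u := fun x => u x + r) (G := G) hL hC hG
        (by simpa using hLip) (by simpa using hu)
      rw [inv_le_iff_one_le_mul₀ (by positivity), mul_assoc]
      rw [← div_eq_inv_mul, le_div_iff₀ (normalPDF_pos _), one_mul, mul_comm]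
      exact h) hst
  simp only [Function.comp] at this
  rw [div_eq_inv_mul]
  linarith

end

section

/-- A smoothing of the distance function to `P`, bounded below by `η`. -/
noncomputable def smoothDist {E : Type*} [PseudoMetricSpace E] (P : Set E) (η : ℝ) (x : E) : ℝ :=
  √(Metric.infDist x P ^ 2 + η ^ 2)

section Metric

variable {E : Type*} [PseudoMetricSpace E] {P : Set E} {η : ℝ}

lemma infDist_le_smoothDist (x : E) : Metric.infDist x P ≤ smoothDist P η x :=
  Real.le_sqrt_of_sq_le (by nlinarith [sq_nonneg η])

lemma le_smoothDist (x : E) : η ≤ smoothDist P η x :=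
  Real.le_sqrt_of_sq_le (by nlinarith [sq_nonneg (Metric.infDist x P)])

lemma smoothDist_of_mem (hη : 0 ≤ η) {x : E} (hx : x ∈ P) : smoothDist P η x = η := by
  simp [smoothDist, Metric.infDist_zero_of_mem hx, hη]

lemma smoothDist_sq (x : E) : smoothDist P η x ^ 2 = Metric.infDist x P ^ 2 + η ^ 2 :=
  Real.sq_sqrt (by positivity)

lemma abs_smoothDist_sub_le (hη : 0 < η) (x y : E) :
    |smoothDist P η y - smoothDist P η x| ≤ dist y x := by
  have h1 : |Metric.infDist y P - Metric.infDist x P| ≤ dist y x := by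
    have e1 := Metric.infDist_le_infDist_add_dist (s := P) (x := x) (y := y)
    have e2 := Metric.infDist_le_infDist_add_dist (s := P) (x := y) (y := x)
    rw [dist_comm] at e1
    rw [abs_le]
    constructor <;> linarith
  refine le_trans ?_ h1
  have hx := le_smoothDist (P := P) (η := η) x
  have hy := le_smoothDist (P := P) (η := η) y
  have hs : 0 < smoothDist P η y + smoothDist P η x := by linarith
  have e : |smoothDist P η y - smoothDist P η x| * (smoothDist P η y + smoothDist P η x)
      = |Metric.infDist y P - Metric.infDist x P|
        * (Metric.infDist y P + Metric.infDist x P) := by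
    rw [← abs_of_pos hs, ← abs_mul,
      ← abs_of_nonneg (a := Metric.infDist y P + Metric.infDist x P)
        (add_nonneg Metric.infDist_nonneg Metric.infDist_nonneg), ← abs_mul]
    congr 1
    linear_combination smoothDist_sq (P := P) (η := η) y - smoothDist_sq (P := P) (η := η) x
  rw [← mul_le_mul_iff_left₀ hs, e]
  gcongr <;> exact infDist_le_smoothDist _

end Metric

variable {E : Type*} [NormedAddCommGroup E] [InnerProductSpace ℝ E]

lemma exists_projection [CompleteSpace E] {P : Set E} (hne : P.Nonempty) (hcl : IsClosed P)
    (hcv : Convex ℝ P) (x : E) :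
    ∃ v ∈ P, ‖x - v‖ = Metric.infDist x P ∧ ∀ w ∈ P, ⟪x - v, w - v⟫ ≤ 0 := by
  obtain ⟨v, hv, e⟩ := exists_norm_eq_iInf_of_complete_convex hne hcl.isComplete hcv x
  refine ⟨v, hv, ?_, (norm_eq_iInf_iff_real_inner_le_zero hcv hv).1 e⟩
  rw [e, Metric.infDist_eq_iInf]
  simp [dist_eq_norm]

lemma smoothDist_expansion [CompleteSpace E] {P : Set E} (hne : P.Nonempty) (hcl : IsClosed P)
    (hcv : Convex ℝ P) {η : ℝ} (hη : 0 < η) :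
    ∃ G : E → E, (∀ x, ‖G x‖ ≤ 1) ∧
      ∀ x y, |smoothDist P η y - smoothDist P η x - ⟪G x, y - x⟫| ≤ η⁻¹ * ‖y - x‖ ^ 2 := by
  choose π hπ hnorm hinner using exists_projection hne hcl hcv
  have hg (x : E) : 0 < smoothDist P η x := hη.trans_le (le_smoothDist x)
  refine ⟨fun x => (smoothDist P η x)⁻¹ • (x - π x), fun x => ?_, fun x y => ?_⟩
  · rw [norm_smul, norm_inv, Real.norm_eq_abs, abs_of_pos (hg x), hnorm,
      inv_mul_le_iff₀ (hg x), mul_one]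
    exact infDist_le_smoothDist x
  have upper (x y : E) : Metric.infDist y P ^ 2
      ≤ Metric.infDist x P ^ 2 + 2 * ⟪x - π x, y - x⟫ + ‖y - x‖ ^ 2 := by
    have h1 : Metric.infDist y P ≤ ‖(x - π x) + (y - x)‖ := by
      have := Metric.infDist_le_dist_of_mem (x := y) (hπ x)
      rw [dist_eq_norm] at this
      rwa [show (x - π x) + (y - x) = y - π x by abel]
    have h2 := pow_le_pow_left₀ Metric.infDist_nonneg h1 2
    rwa [norm_add_sq_real, hnorm] at h2
  have hmono : 0 ≤ ⟪(y - π y) - (x - π x), y - x⟫ := by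
    have h1 := hinner x (π y) (hπ y)
    have h2 := hinner y (π x) (hπ x)
    have h3 : (y - x : E) = ((y - π y) - (x - π x)) + (π y - π x) := by abel
    have h4 : ⟪y - π y, π x - π y⟫ = -⟪y - π y, π y - π x⟫ := by
      rw [← inner_neg_right, neg_sub]
    have h5 : 0 ≤ ⟪(y - π y) - (x - π x), (y - π y) - (x - π x)⟫ := real_inner_self_nonneg
    rw [h3, inner_add_right, inner_sub_left (y - π y) (x - π x) (π y - π x)]
    linarith
  set v := y - x with hv
  set a := smoothDist P η x with ha
  set c := smoothDist P η y with hc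
  set m := ⟪x - π x, v⟫ with hm
  have hR1 : c ^ 2 - a ^ 2 - 2 * m ≤ ‖v‖ ^ 2 := by
    have := upper x y
    rw [hc, ha, smoothDist_sq, smoothDist_sq]
    linarith
  have hR2 : -‖v‖ ^ 2 ≤ c ^ 2 - a ^ 2 - 2 * m := by
    have h1 := upper y x
    rw [show x - y = -v by rw [hv]; abel, norm_neg, inner_neg_right] at h1
    rw [inner_sub_left] at hmono
    rw [hc, ha, smoothDist_sq, smoothDist_sq]
    linarith
  have hR : |c ^ 2 - a ^ 2 - 2 * m| ≤ ‖v‖ ^ 2 := abs_le.2 ⟨hR2, hR1⟩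
  have ha0 : 0 < a := hg x
  have hc0 : 0 < c := hg y
  have haη : η ≤ a := le_smoothDist x
  have hcη : η ≤ c := le_smoothDist y
  have hm' : |m| ≤ a * ‖v‖ := by
    refine (abs_real_inner_le_norm _ _).trans ?_
    rw [hnorm]
    gcongr
    exact infDist_le_smoothDist x
  have hLip : |a - c| ≤ ‖v‖ := by
    rw [abs_sub_comm, ← dist_eq_norm]
    exact abs_smoothDist_sub_le hη x y
  rw [real_inner_smul_left]
  have e : c - a - a⁻¹ * m
      = (c ^ 2 - a ^ 2 - 2 * m) / (c + a) + m * (a - c) / (a * (c + a)) := by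
    field_simp
    ring
  rw [e]
  have hca : 2 * η ≤ c + a := by linarith
  have b1 : |(c ^ 2 - a ^ 2 - 2 * m) / (c + a)| ≤ ‖v‖ ^ 2 / (2 * η) := by
    rw [abs_div, abs_of_pos (by positivity : 0 < c + a)]
    gcongr
  have b2 : |m * (a - c) / (a * (c + a))| ≤ ‖v‖ ^ 2 / (2 * η) := by
    rw [abs_div, abs_mul, abs_of_pos (by positivity : 0 < a * (c + a))]
    calc |m| * |a - c| / (a * (c + a)) ≤ (a * ‖v‖) * ‖v‖ / (a * (c + a)) := by gcongr
      _ = ‖v‖ ^ 2 / (c + a) := by field_simp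
      _ ≤ _ := by gcongr
  calc _ ≤ _ := abs_add_le _ _
    _ ≤ ‖v‖ ^ 2 / (2 * η) + ‖v‖ ^ 2 / (2 * η) := add_le_add b1 b2
    _ = η⁻¹ * ‖v‖ ^ 2 := by field_simp; ring

variable [MeasurableSpace E] [BorelSpace E] [FiniteDimensional ℝ E]

lemma isoperimetry_approx {P : Set E} (hne : P.Nonempty) (hcl : IsClosed P)
    (hcv : Convex ℝ P) {q r ρ : ℝ} (hq : normalCDF q ≤ (stdGaussian E).real P) {n : ℕ} (hn : 0 < n)
    (hρ : n + 1 ≤ (n : ℝ) ^ 2 * ρ) :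
    normalCDF (normalQuantile (normalCDF q * normalCDF n)
        + ((n : ℝ) ^ 2 * ρ - (n + 1)) / (1 + (n : ℝ) ^ 2))
      ≤ (stdGaussian E).real {x | Metric.infDist x P ≤ r}
        + normalCDF ((n : ℝ) ^ 2 * (ρ - r)) := by
  set γ := stdGaussian E
  set L : ℝ := (n : ℝ) ^ 2 with hLdef
  have hL : 0 < L := by positivity
  set η : ℝ := L⁻¹ with hηdef
  have hη : 0 < η := by positivity
  obtain ⟨G, hG, hexp⟩ := smoothDist_expansion hne hcl hcv hη
  set u : E → ℝ := fun x => -(L * smoothDist P η x) with hu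
  have hLip (x y : E) : |u y - u x| ≤ L * ‖y - x‖ := by
    have h := abs_smoothDist_sub_le (P := P) hη x y
    rw [dist_eq_norm] at h
    rw [show u y - u x = -(L * (smoothDist P η y - smoothDist P η x)) by simp only [hu]; ring,
      abs_neg, abs_mul, abs_of_pos hL]
    gcongr
  have hcont : Continuous u := by
    refine (LipschitzWith.of_dist_le_mul (K := ⟨L, hL.le⟩) fun x y => ?_).continuous
    rw [Real.dist_eq, dist_eq_norm]
    exact hLip y x
  have hmain := normalQuantile_integral_add_le (u := u) (G := fun x => -(L • G x)) (L := L)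
    (C := L * η⁻¹) hL.le (by positivity) (fun x => by
      rw [norm_neg, norm_smul, Real.norm_eq_abs, abs_of_pos hL]
      exact mul_le_of_le_one_right hL.le (hG x)) hLip (fun x y => by
      rw [inner_neg_left, real_inner_smul_left, show u y - u x - -(L * ⟪G x, y - x⟫)
        = -(L * (smoothDist P η y - smoothDist P η x - ⟪G x, y - x⟫)) by simp only [hu]; ring,
        abs_neg, abs_mul, abs_of_pos hL, mul_assoc]
      gcongr
      exact hexp x y) hρ
  set F : ℝ → ℝ := fun s => ∫ x, normalCDF (u x + s) ∂γ with hF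
  have hFmem (s : ℝ) : F s ∈ Set.Ioo (0 : ℝ) 1 :=
    integral_normalCDF_comp_mem_Ioo _ (hcont.measurable.add_const s)
  have hFint (s : ℝ) : Integrable (fun x => normalCDF (u x + s)) γ :=
    integrable_normalCDF_comp _ (hcont.measurable.add_const s)
  have hlow : normalCDF q * normalCDF n ≤ F (n + 1) := by
    calc normalCDF q * normalCDF n ≤ γ.real P * normalCDF n := by
          gcongr
          exact (normalCDF_mem_Ioo _).1.le
      _ = ∫ x, P.indicator (fun _ => normalCDF n) x ∂γ := by
          rw [integral_indicator_const _ hcl.measurableSet, smul_eq_mul]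
      _ ≤ F (n + 1) := by
          refine integral_mono ((integrable_const _).indicator hcl.measurableSet) (hFint _)
            fun x => ?_
          by_cases hx : x ∈ P
          · have : u x = -1 := by
              simp only [hu]
              rw [smoothDist_of_mem hη.le hx, hηdef, mul_inv_cancel₀ hL.ne']
            simp [hx, this]
          · simpa [hx] using (normalCDF_mem_Ioo _).1.le
  have hDmeas : MeasurableSet {x : E | Metric.infDist x P ≤ r} :=
    measurableSet_le (Metric.continuous_infDist_pt P).measurable measurable_const
  have hup : F (L * ρ) ≤ γ.real {x | Metric.infDist x P ≤ r} + normalCDF (L * (ρ - r)) := by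
    calc F (L * ρ) ≤ ∫ x, ({x | Metric.infDist x P ≤ r}.indicator (fun _ => (1 : ℝ)) x
          + normalCDF (L * (ρ - r))) ∂γ := by
          refine integral_mono (hFint _)
            (((integrable_const _).indicator hDmeas).add (integrable_const _)) fun x => ?_
          by_cases hx : Metric.infDist x P ≤ r
          · have h1 := (normalCDF_mem_Ioo (u x + L * ρ)).2
            have h2 := (normalCDF_mem_Ioo (L * (ρ - r))).1
            simp [hx]
            linarith
          · have h1 : u x + L * ρ ≤ L * (ρ - r) := by
              have := infDist_le_smoothDist (P := P) (η := η) x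
              simp only [hu]
              nlinarith
            simpa [hx] using strictMono_normalCDF.monotone h1
      _ = _ := by
          rw [integral_add ((integrable_const _).indicator hDmeas) (integrable_const _),
            integral_indicator_const _ hDmeas]
          simp
  have hq01 := normalCDF_mem_Ioo q
  have hn01 := normalCDF_mem_Ioo n
  have hprod : normalCDF q * normalCDF n ∈ Set.Ioo (0 : ℝ) 1 :=
    ⟨mul_pos hq01.1 hn01.1, by nlinarith [hq01.1, hq01.2, hn01.1, hn01.2]⟩
  have hquant := strictMonoOn_normalQuantile.monotoneOn hprod (hFmem _) hlow
  calc _ ≤ normalCDF (normalQuantile (F (L * ρ))) :=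
        strictMono_normalCDF.monotone (le_trans (by gcongr) hmain)
    _ = F (L * ρ) := normalCDF_normalQuantile (hFmem _)
    _ ≤ _ := hup

/-- The Gaussian isoperimetric inequality for convex sets in finite dimension. -/
theorem isoperimetry_convex {P : Set E} (hne : P.Nonempty) (hcl : IsClosed P)
    (hcv : Convex ℝ P) {q r : ℝ} (hr : 0 < r) (hq : normalCDF q ≤ (stdGaussian E).real P) :
    normalCDF (q + r) ≤ (stdGaussian E).real {x | Metric.infDist x P ≤ r} := by
  have key : ∀ ρ ∈ Set.Ioo 0 r,
      normalCDF (q + ρ) ≤ (stdGaussian E).real {x | Metric.infDist x P ≤ r} := by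
    intro ρ hρ
    have hnat : Tendsto (fun n : ℕ => (n : ℝ)) atTop atTop := tendsto_natCast_atTop_atTop
    have hinv : Tendsto (fun n : ℕ => (n : ℝ)⁻¹) atTop (𝓝 0) := tendsto_inv_atTop_zero.comp hnat
    have h1 : Tendsto (fun n : ℕ => normalCDF ((n : ℝ) ^ 2 * (ρ - r))) atTop (𝓝 0) :=
      tendsto_normalCDF_atBot.comp
        (((tendsto_pow_atTop two_ne_zero).comp hnat).atTop_mul_const_of_neg (by linarith [hρ.2]))
    have h2 : Tendsto (fun n : ℕ => ((n : ℝ) ^ 2 * ρ - (n + 1)) / (1 + (n : ℝ) ^ 2)) atTop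
        (𝓝 ρ) := by
      have : Tendsto (fun n : ℕ => (ρ - (n : ℝ)⁻¹ - (n : ℝ)⁻¹ ^ 2) / ((n : ℝ)⁻¹ ^ 2 + 1)) atTop
          (𝓝 ((ρ - 0 - 0 ^ 2) / (0 ^ 2 + 1))) :=
        (((tendsto_const_nhds.sub hinv).sub (hinv.pow 2))).div ((hinv.pow 2).add_const 1)
          (by norm_num)
      simp only [ne_eq, OfNat.ofNat_ne_zero, not_false_eq_true, zero_pow, sub_zero, zero_add,
        div_one] at this
      refine this.congr' ?_
      filter_upwards [eventually_gt_atTop 0] with n hn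
      have : (0 : ℝ) < n := by exact_mod_cast hn
      field_simp
      ring
    have h3 : Tendsto (fun n : ℕ => normalQuantile (normalCDF q * normalCDF n)) atTop (𝓝 q) := by
      have := (continuousAt_normalQuantile (normalCDF_mem_Ioo q)).tendsto.comp
        (by simpa using (tendsto_normalCDF_atTop.comp hnat).const_mul (normalCDF q))
      rwa [normalQuantile_normalCDF] at this
    have h4 := (continuous_normalCDF.tendsto (q + ρ)).comp (h3.add h2)
    have h5 := h1.const_add ((stdGaussian E).real {x | Metric.infDist x P ≤ r})
    rw [add_zero] at h5
    refine le_of_tendsto_of_tendsto h4 h5 ?_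
    have h6 : ∀ᶠ n : ℕ in atTop, 2 / ρ ≤ (n : ℝ) := hnat.eventually_ge_atTop _
    filter_upwards [h6, eventually_gt_atTop 0] with n hn hn0
    refine isoperimetry_approx hne hcl hcv hq hn0 ?_
    have : (1 : ℝ) ≤ n := by exact_mod_cast hn0
    rw [div_le_iff₀ hρ.1] at hn
    nlinarith
  have hlim : Tendsto (fun ρ => normalCDF (q + ρ)) (𝓝[<] r) (𝓝 (normalCDF (q + r))) :=
    ((continuous_normalCDF.comp (continuous_const.add continuous_id)).tendsto r).mono_left
      nhdsWithin_le_nhds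
  refine le_of_tendsto hlim ?_
  filter_upwards [Ioo_mem_nhdsLT hr] with ρ hρ using key ρ hρ

end

section

variable {X H : Type*} [NormedAddCommGroup X] [NormedSpace ℝ X] [NormedAddCommGroup H]
  [InnerProductSpace ℝ H]

/-- In a separable space countably many functionals determine the closed balls around zero. -/
lemma exists_norming_seq [TopologicalSpace.SeparableSpace X] :
    ∃ L : ℕ → X →L[ℝ] ℝ, ∀ (x : X) (c : ℝ), ‖x‖ ≤ c ↔ ∀ k, L k x ≤ c := by
  choose L hL hLx using fun k => exists_dual_vector'' ℝ (TopologicalSpace.denseSeq X k)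
  refine ⟨L, fun x c => ⟨fun h k => ?_, fun h => ?_⟩⟩
  · calc L k x ≤ ‖L k x‖ := Real.le_norm_self _
      _ ≤ ‖L k‖ * ‖x‖ := (L k).le_opNorm x
      _ ≤ 1 * ‖x‖ := by gcongr; exact hL k
      _ ≤ c := by rwa [one_mul]
  · refine le_of_forall_pos_le_add fun δ hδ => ?_
    obtain ⟨k, hk⟩ := (TopologicalSpace.denseRange_denseSeq X).exists_dist_lt x (half_pos hδ)
    set y := TopologicalSpace.denseSeq X k with hy
    rw [dist_eq_norm] at hk
    have h1 : ‖y‖ = L k x + L k (y - x) := by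
      rw [← map_add, add_sub_cancel]
      exact (hLx k).symm
    have h2 : L k (y - x) ≤ ‖x - y‖ := by
      calc L k (y - x) ≤ ‖L k (y - x)‖ := Real.le_norm_self _
        _ ≤ ‖L k‖ * ‖y - x‖ := (L k).le_opNorm _
        _ ≤ 1 * ‖y - x‖ := by gcongr; exact hL k
        _ = ‖x - y‖ := by rw [one_mul, norm_sub_rev]
    have h3 : ‖x‖ ≤ ‖x - y‖ + ‖y‖ := norm_le_norm_sub_add x y
    linarith [h k]

/-- The points that a shift by a vector of norm at most `r` moves into a polyhedron. -/
def shiftSet (L : ℕ → X →L[ℝ] ℝ) (g : ℕ → H) (c r : ℝ) (m : ℕ) : Set X :=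
  {x | ∃ h : H, ‖h‖ ≤ r ∧ ∀ k < m, L k x - ⟪g k, h⟫ ≤ c}

lemma antitone_shiftSet (L : ℕ → X →L[ℝ] ℝ) (g : ℕ → H) (c r : ℝ) :
    Antitone (shiftSet L g c r) := fun _ _ hmn _ ⟨h, hr, hh⟩ =>
  ⟨h, hr, fun k hk => hh k (hk.trans_le hmn)⟩

section Weak

/-- The closed ball of the dual of `H` with the weak star topology. -/
abbrev weakBall (H : Type*) [NormedAddCommGroup H] [InnerProductSpace ℝ H] (r : ℝ) :
    Set (WeakDual ℝ H) :=
  WeakDual.toStrongDual ⁻¹' Metric.closedBall 0 r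

instance (r : ℝ) : CompactSpace (weakBall H r) :=
  isCompact_iff_compactSpace.1 (WeakDual.isCompact_closedBall 0 r)

lemma continuous_weakBall_apply {r : ℝ} (g : H) :
    Continuous fun φ : weakBall H r => φ.1 g :=
  (WeakDual.eval_continuous g).comp continuous_subtype_val

variable [CompleteSpace H]

lemma exists_norm_le_iff_exists_weakBall {r : ℝ} {p : (H → ℝ) → Prop} :
    (∃ h : H, ‖h‖ ≤ r ∧ p fun g => ⟪g, h⟫) ↔ ∃ φ : weakBall H r, p fun g => φ.1 g := by
  constructor
  · rintro ⟨h, hr, hp⟩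
    refine ⟨⟨StrongDual.toWeakDual (InnerProductSpace.toDual ℝ H h), ?_⟩, ?_⟩
    · simpa using hr
    · convert! hp using 2 with g
      exact real_inner_comm _ _
  · rintro ⟨⟨φ, hφ⟩, hp⟩
    refine ⟨(InnerProductSpace.toDual ℝ H).symm (WeakDual.toStrongDual φ), ?_, ?_⟩
    · simpa using hφ
    · convert! hp using 2 with g
      rw [real_inner_comm, InnerProductSpace.toDual_symm_apply]
      rfl

lemma isClosed_shiftSet (L : ℕ → X →L[ℝ] ℝ) (g : ℕ → H) (c r : ℝ) (m : ℕ) :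
    IsClosed (shiftSet L g c r m) := by
  have h : IsClosed {z : weakBall H r × X | ∀ k < m, L k z.2 - z.1.1 (g k) ≤ c} := by
    simp only [Set.ofPred_forall]
    refine isClosed_iInter fun k => isClosed_iInter fun _ => isClosed_le ?_ continuous_const
    exact ((L k).continuous.comp continuous_snd).sub
      ((continuous_weakBall_apply (g k)).comp continuous_fst)
  convert! isClosedMap_snd_of_compactSpace _ h using 1
  ext x
  have := exists_norm_le_iff_exists_weakBall (H := H) (r := r)
    (p := fun f => ∀ k < m, L k x - f (g k) ≤ c)
  simpa [shiftSet] using this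

lemma mem_iInter_shiftSet {L : ℕ → X →L[ℝ] ℝ} {g : ℕ → H} {c r : ℝ} {x : X} :
    x ∈ ⋂ m, shiftSet L g c r m ↔ ∃ h : H, ‖h‖ ≤ r ∧ ∀ k, L k x - ⟪g k, h⟫ ≤ c := by
  refine ⟨fun hx => ?_, fun ⟨h, hr, hh⟩ => Set.mem_iInter.2 fun m => ⟨h, hr, fun k _ => hh k⟩⟩
  refine (exists_norm_le_iff_exists_weakBall (p := fun f => ∀ k, L k x - f (g k) ≤ c)).2 ?_
  let t : ℕ → Set (weakBall H r) := fun m => {φ | ∀ k < m, L k x - φ.1 (g k) ≤ c}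
  have ht : ∀ m, IsClosed (t m) := fun m => by
    simp only [t, Set.ofPred_forall]
    exact isClosed_iInter fun k => isClosed_iInter fun _ =>
      isClosed_le (continuous_const.sub (continuous_weakBall_apply (g k))) continuous_const
  obtain ⟨φ, hφ⟩ := IsCompact.nonempty_iInter_of_sequence_nonempty_isCompact_isClosed t
    (fun m φ hφ k hk => hφ k (hk.trans m.lt_succ_self))
    (fun m => (exists_norm_le_iff_exists_weakBall
      (p := fun f => ∀ k < m, L k x - f (g k) ≤ c)).1 (Set.mem_iInter.1 hx m)) (ht 0).isCompact ht
  exact ⟨φ, fun k => Set.mem_iInter.1 hφ (k + 1) k k.lt_succ_self⟩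

end Weak

section Law

variable [MeasurableSpace X] [BorelSpace X] {μ : Measure X}

lemma map_eq_gaussianReal_of_integral_sq {L : X →L[ℝ] ℝ} {v : NNReal}
    (hv : μ.map L = gaussianReal 0 v) {s : ℝ} (hs : ∫ x, L x * L x ∂μ = s ^ 2) :
    μ.map L = gaussianReal 0 (‖s‖₊ ^ 2) := by
  have h1 : ∫ x, L x * L x ∂μ = v := by
    have h2 := variance_id_gaussianReal (μ := 0) (v := v)
    rw [variance_eq_integral aemeasurable_id] at h2
    simp only [id_eq, integral_id_gaussianReal, sub_zero] at h2
    rw [← hv, integral_map L.continuous.aemeasurable (by fun_prop)] at h2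
    simpa [pow_two] using h2
  rw [hv]
  congr 1
  ext
  simp [← h1, hs]

variable {S : (X →L[ℝ] ℝ) →ₗ[ℝ] H}

lemma ae_eq_of_apply_eq (hS : ∀ L : X →L[ℝ] ℝ, μ.map L = gaussianReal 0 (‖S L‖₊ ^ 2))
    {L₁ L₂ : X →L[ℝ] ℝ}
    (h : S L₁ = S L₂) : ∀ᵐ x ∂μ, L₁ x = L₂ x := by
  have h1 := hS (L₁ - L₂)
  rw [map_sub, h, sub_self, nnnorm_zero, zero_pow two_ne_zero, gaussianReal_zero_var] at h1
  have h2 : ∀ᵐ y ∂(μ.map (L₁ - L₂ : X →L[ℝ] ℝ)), y = 0 := by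
    rw [h1]
    exact (ae_dirac_iff (measurableSet_singleton (0 : ℝ))).2 rfl
  filter_upwards [ae_of_ae_map (L₁ - L₂).continuous.aemeasurable h2] with x hx
  simpa [sub_eq_zero] using hx

/-- Every finite-dimensional space in the range of the covariance operator `S` carries an image of
`μ` that is standard Gaussian, and on which the functionals act through `S`. -/
lemma exists_map_eq_stdGaussian [IsProbabilityMeasure μ]
    (hS : ∀ L : X →L[ℝ] ℝ, μ.map L = gaussianReal 0 (‖S L‖₊ ^ 2)) (V : Submodule ℝ H)
    [FiniteDimensional ℝ V] [MeasurableSpace V] [BorelSpace V] (hV : V ≤ LinearMap.range S) :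
    ∃ π : X →L[ℝ] V, μ.map π = stdGaussian V ∧
      ∀ L (hL : S L ∈ V), ∀ᵐ x ∂μ, L x = ⟪(⟨S L, hL⟩ : V), π x⟫ := by
  choose T hT using fun v : V => hV v.2
  let b := stdOrthonormalBasis ℝ V
  let π : X →L[ℝ] V := ∑ j, (T (b j)).smulRight (b j)
  have hπ : ∀ t : V, ∃ L, S L = t ∧ ∀ x, L x = ⟪t, π x⟫ := fun t => by
    refine ⟨∑ j, ⟪b j, t⟫ • T (b j), ?_, fun x => ?_⟩
    · rw [map_sum]
      simp only [map_smul, hT]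
      conv_rhs => rw [← b.sum_repr' t]
      simp
    · simp [π, inner_sum, inner_smul_right, mul_comm, real_inner_comm t]
  refine ⟨π, ?_, fun L hL => ?_⟩
  · have : IsProbabilityMeasure (μ.map π) :=
      Measure.isProbabilityMeasure_map π.continuous.aemeasurable
    refine Measure.ext_of_charFun (funext fun t => ?_)
    obtain ⟨L, hLt, hL⟩ := hπ t
    have h1 : charFun (μ.map π) t = charFun (μ.map L) 1 := by
      rw [charFun_apply, charFun_apply, integral_map π.continuous.aemeasurable (by fun_prop),
        integral_map L.continuous.aemeasurable (by fun_prop)]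
      simp [hL, real_inner_comm t]
    rw [h1, hS, charFun_gaussianReal, charFun_stdGaussian, hLt]
    simp [neg_div]
  · obtain ⟨L', hL', hx⟩ := hπ ⟨S L, hL⟩
    filter_upwards [ae_eq_of_apply_eq hS hL'.symm] with x h
    rw [h, hx]

lemma le_measure_shiftSet [IsProbabilityMeasure μ]
    (hS : ∀ L : X →L[ℝ] ℝ, μ.map L = gaussianReal 0 (‖S L‖₊ ^ 2)) (L : ℕ → X →L[ℝ] ℝ)
    {c q r : ℝ}
    (hc : 0 ≤ c) (hr : 0 < r) (hq : normalCDF q ≤ μ.real {x | ∀ k, L k x ≤ c}) (m : ℕ) :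
    normalCDF (q + r) ≤ μ.real (shiftSet L (fun k => S (L k)) c r m) := by
  let V : Submodule ℝ H := Submodule.span ℝ ((fun k => S (L k)) '' Set.Iio m)
  have : FiniteDimensional ℝ V :=
    FiniteDimensional.span_of_finite ℝ ((Set.finite_Iio m).image _)
  let _ : MeasurableSpace V := borel V
  have : BorelSpace V := ⟨rfl⟩
  have hmem : ∀ k < m, S (L k) ∈ V := fun k hk => Submodule.subset_span ⟨k, hk, rfl⟩
  obtain ⟨π, hπ, hLπ⟩ := exists_map_eq_stdGaussian hS V <| Submodule.span_le.2 <| by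
    rintro _ ⟨k, -, rfl⟩
    exact ⟨L k, rfl⟩
  let P : Set V := {v | ∀ k < m, ⟪S (L k), (v : H)⟫ ≤ c}
  have hP : P = ⋂ k, ⋂ (_ : k < m), {v : V | ⟪S (L k), (v : H)⟫ ≤ c} := by
    ext; simp [P]
  have hcl : IsClosed P := by
    rw [hP]
    exact isClosed_iInter fun k => isClosed_iInter fun _ =>
      isClosed_le (by fun_prop) continuous_const
  have hcv : Convex ℝ P := by
    rw [hP]
    refine convex_iInter fun k => convex_iInter fun _ => ?_
    exact convex_halfSpace_le
      (((innerSL ℝ (S (L k))).toLinearMap.comp V.subtype).isLinear) c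
  have hne : P.Nonempty := ⟨0, fun k _ => by simpa using hc⟩
  have hae : ∀ᵐ x ∂μ, ∀ k < m, L k x = ⟪S (L k), (π x : H)⟫ := by
    rw [ae_all_iff]
    intro k
    by_cases hk : k < m
    · filter_upwards [hLπ (L k) (hmem k hk)] with x hx _ using hx
    · exact Eventually.of_forall fun x h => absurd h hk
  have hqP : normalCDF q ≤ (stdGaussian V).real P := by
    rw [← hπ, map_measureReal_apply π.continuous.measurable hcl.measurableSet]
    refine hq.trans (ENNReal.toReal_mono (measure_ne_top _ _) (measure_mono_ae ?_))
    filter_upwards [hae] with x hx hxc k hk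
    rw [← hx k hk]
    exact hxc k
  refine (isoperimetry_convex hne hcl hcv hr hqP).trans ?_
  rw [← hπ, map_measureReal_apply π.continuous.measurable
    (isClosed_le (Metric.continuous_infDist_pt P) continuous_const).measurableSet]
  refine ENNReal.toReal_mono (measure_ne_top _ _) (measure_mono_ae ?_)
  filter_upwards [hae] with x hx hxr
  obtain ⟨p, hp, hdist, -⟩ := exists_projection hne hcl hcv (π x)
  refine ⟨(π x - p : V), ?_, fun k hk => ?_⟩
  · exact hdist.trans_le hxr
  · rw [hx k hk, Submodule.coe_sub, inner_sub_right, sub_sub_cancel]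
    exact hp k hk

end Law

/-- **Gaussian isoperimetric inequality** for centred balls: the enlargement of a ball by
the ball of radius `r` of the reproducing kernel Hilbert space. -/
theorem isoperimetry_closedBall [TopologicalSpace.SeparableSpace X] [MeasurableSpace X]
    [BorelSpace X] [CompleteSpace H] {μ : Measure X} [IsProbabilityMeasure μ] (ι : H →L[ℝ] X)
    {S : (X →L[ℝ] ℝ) →ₗ[ℝ] H} (hS : ∀ L : X →L[ℝ] ℝ, μ.map L = gaussianReal 0 (‖S L‖₊ ^ 2))
    (hSι : ∀ L h, ⟪S L, h⟫ = L (ι h)) {c q r : ℝ} (hc : 0 ≤ c) (hr : 0 < r)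
    (hq : normalCDF q ≤ μ.real {x | ‖x‖ ≤ c}) :
    normalCDF (q + r) ≤ μ.real {x | ∃ h : H, ‖h‖ ≤ r ∧ ‖x - ι h‖ ≤ c} := by
  obtain ⟨L, hL⟩ := exists_norming_seq (X := X)
  have hset : {x | ∃ h : H, ‖h‖ ≤ r ∧ ‖x - ι h‖ ≤ c} =
      ⋂ m, shiftSet L (fun k => S (L k)) c r m := by
    ext x
    rw [mem_iInter_shiftSet]
    simp [hL, hSι]
  simp only [hL] at hq
  have hlim := tendsto_measure_iInter_atTop (μ := μ)
    (fun m => (isClosed_shiftSet L (fun k => S (L k)) c r m).measurableSet.nullMeasurableSet)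
    (antitone_shiftSet L _ c r) ⟨0, measure_ne_top _ _⟩
  rw [hset]
  exact ge_of_tendsto' ((ENNReal.tendsto_toReal (measure_ne_top _ _)).comp hlim)
    fun m => le_measure_shiftSet hS L hc hr hq m

end

end GaussianIsoperimetry

/-- Consequence of the Gaussian isoperimetric inequality: if a centred Gaussian
measure `Π'` with RKHS `H` satisfies `Π'(‖F‖_X ≤ Qε) ≥ e^{-Bτ²}` and
`M ≥ -2Φ_N^{-1}(e^{-Bτ²})/τ`, then
`Π'(F = F₁ + F₂, ‖F₁‖_X ≤ Qε, ‖F₂‖_H ≤ Mτ) ≥ 1 - e^{-Bτ²}`. -/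
theorem gaussian_isoperimetry_decomposition
    {X H : Type*} [NormedAddCommGroup X] [NormedSpace ℝ X] [CompleteSpace X]
    [TopologicalSpace.SeparableSpace X] [MeasurableSpace X] [BorelSpace X]
    [NormedAddCommGroup H] [InnerProductSpace ℝ H] [CompleteSpace H]
    (μ : Measure X) [IsProbabilityMeasure μ]
    (ι : H →L[ℝ] X) (hι : Function.Injective ι)
    (hGauss : ∀ L : X →L[ℝ] ℝ, ∃ v : NNReal, Measure.map L μ = gaussianReal 0 v)
    (S : (X →L[ℝ] ℝ) → H)
    (hRKHS₁ : ∀ (L : X →L[ℝ] ℝ) (h : H), ⟪S L, h⟫ = L (ι h))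
    (hRKHS₂ : ∀ L₁ L₂ : X →L[ℝ] ℝ, ∫ x, L₁ x * L₂ x ∂μ = ⟪S L₁, S L₂⟫)
    (B Q M τ ε : ℝ) (hB : 0 < B) (hQ : 0 < Q) (hM : 0 < M) (hτ : 0 < τ)
    (hε : 0 < ε)
    (hsmall : Real.exp (-B * τ ^ 2) ≤ (μ {x | ‖x‖ ≤ Q * ε}).toReal)
    (q : ℝ) (hq : normalCDF q = Real.exp (-B * τ ^ 2))
    (hMq : -2 * q / τ ≤ M) :
    1 - Real.exp (-B * τ ^ 2)
      ≤ (μ {x | ∃ (x₁ : X) (h : H),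
          x = x₁ + ι h ∧ ‖x₁‖ ≤ Q * ε ∧ ‖h‖ ≤ M * τ}).toReal := by
  let S' : (X →L[ℝ] ℝ) →ₗ[ℝ] H :=
    { toFun := S
      map_add' := fun L₁ L₂ => ext_inner_right ℝ fun h => by simp [inner_add_left, hRKHS₁]
      map_smul' := fun a L => ext_inner_right ℝ fun h => by
        simp [real_inner_smul_left, hRKHS₁] }
  have hS : ∀ L : X →L[ℝ] ℝ, μ.map L = gaussianReal 0 (‖S' L‖₊ ^ 2) := fun L => by
    obtain ⟨v, hv⟩ := hGauss L
    have := GaussianIsoperimetry.map_eq_gaussianReal_of_integral_sq hv (s := ‖S L‖)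
      ((hRKHS₂ L L).trans (real_inner_self_eq_norm_sq _))
    rwa [nnnorm_norm] at this
  have hset : {x | ∃ (x₁ : X) (h : H), x = x₁ + ι h ∧ ‖x₁‖ ≤ Q * ε ∧ ‖h‖ ≤ M * τ} =
      {x | ∃ h : H, ‖h‖ ≤ M * τ ∧ ‖x - ι h‖ ≤ Q * ε} := by
    ext x
    constructor
    · rintro ⟨x₁, h, rfl, h₁, h₂⟩
      exact ⟨h, h₂, by simpa using h₁⟩
    · rintro ⟨h, h₂, h₁⟩
      exact ⟨x - ι h, h, by simp, h₁, h₂⟩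
  have hle : -q ≤ q + M * τ := by
    rw [div_le_iff₀ hτ] at hMq
    linarith
  calc 1 - Real.exp (-B * τ ^ 2) = normalCDF (-q) := by
        rw [GaussianIsoperimetry.normalCDF_neg, hq]
    _ ≤ normalCDF (q + M * τ) := GaussianIsoperimetry.strictMono_normalCDF.monotone hle
    _ ≤ _ := by
        rw [hset]
        exact GaussianIsoperimetry.isoperimetry_closedBall ι hS hRKHS₁ (by positivity)
          (by positivity) (hq.trans_le hsmall)
end
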